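/- arXiv:1309.3546 — 2 statements merged into one kernel-verified Lean document; each statement's English description precedes it below -/
import Mathlib

section
/- Let F be a field of characteristic p > 0 and S ⊆ F a finite subset. For any positive integer n, the set n^∧S of all sums of n distinct elements of S satisfies |n^∧S| ≥ min{p, n|S| - n² + 1}. -/
open MvPolynomial in
theorem MvPolynomial.det_vandermonde_X_eq_sum_monomial (R : Type*) [CommRing R] (n : ℕ) :
    (Matrix.vandermonde (X : Fin n → MvPolynomial (Fin n) R)).det =
      ∑ σ : Equiv.Perm (Fin n),
        monomial (Finsupp.equivFunOnFinite.symm fun i ↦ (σ i : ℕ))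
          (((Equiv.Perm.sign σ : ℤ) : R)) := by
  rw [← Matrix.det_transpose, Matrix.det_apply']
  refine Finset.sum_congr rfl fun σ _ ↦ ?_
  simp [monomial_eq, Finsupp.prod_fintype, Matrix.vandermonde_apply]

open MvPolynomial in
theorem MvPolynomial.isHomogeneous_det_vandermonde_X (R : Type*) [CommRing R] (n : ℕ) :
    (Matrix.vandermonde (X : Fin n → MvPolynomial (Fin n) R)).det.IsHomogeneous
      (∑ i : Fin n, (i : ℕ)) := by
  rw [det_vandermonde_X_eq_sum_monomial]
  refine IsHomogeneous.sum _ _ _ fun σ _ ↦ isHomogeneous_monomial _ ?_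
  simp only [Finsupp.degree_eq_sum, Finsupp.equivFunOnFinite_symm_apply_apply]
  exact Equiv.sum_comp σ fun i : Fin n ↦ (i : ℕ)

open MvPolynomial Nat in
theorem MvPolynomial.prod_factorial_mul_coeff_sum_X_pow {σ : Type*} [Fintype σ] (R : Type*)
    [CommRing R] {d : σ →₀ ℕ} {m : ℕ} (hd : d.degree = m) :
    (∏ i, ((d i)! : R)) * coeff d ((∑ i, X i : MvPolynomial σ R) ^ m) = (m ! : R) := by
  have hs : d.sum (fun _ k ↦ k) = m := hd
  have h := Nat.multinomial_spec Finset.univ d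
  rw [← Finsupp.degree_eq_sum, hd] at h
  rw [coeff_sum_X_pow_of_fintype, if_pos hs,
    Finsupp.multinomial_eq_of_support_subset (Finset.subset_univ _), ← h]
  push_cast
  rfl

open MvPolynomial Nat in
/-- The coefficients of the Vandermonde determinant times a power of the sum of the variables. -/
theorem MvPolynomial.prod_factorial_mul_coeff_det_vandermonde_X_mul_sum_X_pow (R : Type*)
    [CommRing R] [IsDomain R] {n m : ℕ} {c : Fin n →₀ ℕ}
    (hc : c.degree = (∑ i : Fin n, (i : ℕ)) + m) :
    (∏ i, ((c i)! : R)) * coeff c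
        ((Matrix.vandermonde (X : Fin n → MvPolynomial (Fin n) R)).det * (∑ i, X i) ^ m) =
      (m ! : R) * (Matrix.vandermonde fun i ↦ (c i : R)).det := by
  rw [det_vandermonde_X_eq_sum_monomial, Matrix.det_eval_matrixOfPolynomials_eq_det_vandermonde _
      (fun j : Fin n ↦ descPochhammer R j) (fun j ↦ descPochhammer_natDegree R j)
      (fun j ↦ monic_descPochhammer R j), ← Matrix.det_transpose (Matrix.of _), Matrix.det_apply',
    Finset.sum_mul, coeff_sum, Finset.mul_sum, Finset.mul_sum]
  refine Finset.sum_congr rfl fun σ _ ↦ ?_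
  simp only [coeff_monomial_mul', Matrix.transpose_apply, Matrix.of_apply,
    descPochhammer_eval_eq_descFactorial]
  set s : Fin n →₀ ℕ := Finsupp.equivFunOnFinite.symm fun i ↦ (σ i : ℕ)
  have hsi (i) : s i = σ i := rfl
  split_ifs with hle
  · have hdeg : (c - s).degree = m := by
      have h1 : (c - s).degree + s.degree = c.degree := by
        rw [← map_add, tsub_add_cancel_of_le hle]
      have h2 : s.degree = ∑ i : Fin n, (i : ℕ) := by
        simp only [Finsupp.degree_eq_sum, hsi]
        exact Equiv.sum_comp σ fun i : Fin n ↦ (i : ℕ)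
      omega
    have hprod : (∏ i, ((c i)! : R)) =
        (∏ i, (((c - s) i)! : R)) * ∏ i, ((c i).descFactorial (σ i) : R) := by
      rw [← Finset.prod_mul_distrib]
      refine Finset.prod_congr rfl fun i _ ↦ ?_
      rw [← Nat.factorial_mul_descFactorial (hle i)]
      push_cast
      rfl
    rw [hprod, ← prod_factorial_mul_coeff_sum_X_pow R hdeg]
    ring
  · obtain ⟨i, hi⟩ : ∃ i, c i < s i := by
      simpa [Finsupp.le_def] using hle
    have hzero : ∏ i, ((c i).descFactorial (σ i) : R) = 0 :=
      Finset.prod_eq_zero (Finset.mem_univ i)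
        (by rw [Nat.descFactorial_eq_zero_iff_lt.mpr (hsi i ▸ hi), Nat.cast_zero])
    rw [hzero, mul_zero, mul_zero, mul_zero]

/-- Hermite's identity for the rational number `m / n`. -/
theorem Nat.sum_range_add_div {n : ℕ} (hn : 0 < n) (m : ℕ) :
    ∑ i ∈ Finset.range n, (m + i) / n = m := by
  induction m with
  | zero =>
    refine Finset.sum_eq_zero fun i hi ↦ ?_
    rw [zero_add, Nat.div_eq_of_lt (Finset.mem_range.mp hi)]
  | succ m ih =>
    have h1 := Finset.sum_range_succ (fun i ↦ (m + i) / n) n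
    have h2 := Finset.sum_range_succ' (fun i ↦ (m + i) / n) n
    have h3 : ∑ i ∈ Finset.range n, (m + 1 + i) / n =
        ∑ i ∈ Finset.range n, (m + (i + 1)) / n :=
      Finset.sum_congr rfl fun i _ ↦ by rw [add_right_comm, add_assoc]
    rw [Nat.add_div_right m hn] at h1
    simp only [add_zero] at h2
    omega

open MvPolynomial in
/-- If some monomial of top degree has a nonzero coefficient in `V * (∑ X i) ^ m`, where `V` is the
Vandermonde determinant, then there are more than `m` sums of `n` distinct elements. -/
theorem Finset.lt_card_image_sum_powersetCard_of_coeff_ne_zero {F : Type*} [Field F]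
    [DecidableEq F] (S : Finset F) {n m : ℕ} {c : Fin n →₀ ℕ} (hcS : ∀ i, c i < S.card)
    (hdeg : c.degree = (∑ i : Fin n, (i : ℕ)) + m)
    (hcoeff : coeff c
      ((Matrix.vandermonde (X : Fin n → MvPolynomial (Fin n) F)).det * (∑ i, X i) ^ m) ≠ 0) :
    m < ((S.powersetCard n).image (fun T => T.sum id)).card := by
  set A := (S.powersetCard n).image (fun T => T.sum id) with hA
  by_contra! hcard
  set V := (Matrix.vandermonde (X : Fin n → MvPolynomial (Fin n) F)).det with hV
  set L : MvPolynomial (Fin n) F := ∑ i, X i with hL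
  let P : Polynomial F := (∏ a ∈ A, (Polynomial.X - Polynomial.C a)) * Polynomial.X ^ (m - A.card)
  have hPm : P.Monic :=
    (Polynomial.monic_prod_of_monic _ _ fun a _ ↦ Polynomial.monic_X_sub_C a).mul
      (Polynomial.monic_X_pow _)
  have hPdeg : P.natDegree = m := by
    rw [Polynomial.Monic.natDegree_mul
      (Polynomial.monic_prod_of_monic _ _ fun a _ ↦ Polynomial.monic_X_sub_C a)
      (Polynomial.monic_X_pow _), Polynomial.natDegree_finsetProd_X_sub_C_eq_card,
      Polynomial.natDegree_X_pow]
    omega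
  have hLhom : L.IsHomogeneous 1 := IsHomogeneous.sum _ _ _ fun i _ ↦ isHomogeneous_X _ _
  have hVL (j : ℕ) : (V * L ^ j).IsHomogeneous ((∑ i : Fin n, (i : ℕ)) + j) := by
    simpa using (isHomogeneous_det_vandermonde_X F n).mul (hLhom.pow j)
  have hf : V * Polynomial.aeval L P =
      ∑ j ∈ range (m + 1), C (P.coeff j) * (V * L ^ j) := by
    rw [Polynomial.aeval_eq_sum_range, hPdeg, mul_sum]
    refine sum_congr rfl fun j _ ↦ ?_
    rw [smul_eq_C_mul]
    ring
  have hfc : coeff c (V * Polynomial.aeval L P) ≠ 0 := by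
    rw [hf, coeff_sum, sum_eq_single m]
    · have : P.coeff m = 1 := by rw [← hPdeg]; exact hPm
      rwa [this, C_1, one_mul]
    · intro j _ hj
      rw [coeff_C_mul, (hVL j).coeff_eq_zero (by omega), mul_zero]
    · simp
  have hfdeg : (V * Polynomial.aeval L P).totalDegree = c.degree := by
    refine le_antisymm ?_ (le_totalDegree (mem_support_iff.mpr hfc))
    rw [hf]
    refine totalDegree_finsetSum_le fun j hj ↦ ?_
    rw [← smul_eq_C_mul]
    refine (totalDegree_smul_le _ _).trans ((hVL j).totalDegree_le.trans ?_)
    have := mem_range.mp hj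
    omega
  obtain ⟨s, hsS, hs⟩ :=
    combinatorial_nullstellensatz_exists_eval_nonzero _ c hfc hfdeg (fun _ ↦ S) hcS
  rw [map_mul] at hs
  have hVs : eval s V = (Matrix.vandermonde s).det := by
    rw [hV, Matrix.det_vandermonde, Matrix.det_vandermonde]
    simp
  have hinj : Function.Injective s := by
    rw [← Matrix.det_vandermonde_ne_zero_iff, ← hVs]
    exact left_ne_zero_of_mul hs
  have hmem : ∑ i, s i ∈ A := by
    refine mem_image.mpr ⟨univ.image s, mem_powersetCard.mpr ⟨?_, ?_⟩, ?_⟩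
    · exact image_subset_iff.mpr fun i _ ↦ hsS i
    · rw [card_image_of_injective _ hinj, card_univ, Fintype.card_fin]
    · rw [sum_image hinj.injOn]
      rfl
  refine right_ne_zero_of_mul hs ?_
  have : eval s (Polynomial.aeval L P) = P.eval (∑ i, s i) := by
    have hC : (eval s).comp C = RingHom.id F := RingHom.ext fun a ↦ eval_C a
    have hLs : eval s L = ∑ i, s i := by simp [hL]
    rw [Polynomial.aeval_def, Polynomial.hom_eval₂, algebraMap_eq, hC, hLs, Polynomial.eval]
  rw [this, Polynomial.eval_mul, Polynomial.eval_prod, prod_eq_zero hmem, zero_mul]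
  rw [Polynomial.eval_sub, Polynomial.eval_X, Polynomial.eval_C, sub_self]

theorem Finset.lt_card_image_sum_powersetCard {F : Type*} [Field F] [DecidableEq F] (p : ℕ)
    [CharP F p] [Fact p.Prime] (S : Finset F) {n m : ℕ} (hn : 0 < n) (hnS : n ≤ S.card)
    (hnp : n < p) (hmp : m < p) (hm : m ≤ n * (S.card - n)) :
    m < ((S.powersetCard n).image (fun T => T.sum id)).card := by
  let c : Fin n →₀ ℕ := Finsupp.equivFunOnFinite.symm fun i ↦ i + (m + i) / n
  have hc (i : Fin n) : c i = i + (m + i) / n := rfl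
  have hdeg : c.degree = (∑ i : Fin n, (i : ℕ)) + m := by
    simp only [Finsupp.degree_eq_sum, hc, sum_add_distrib]
    rw [Fin.sum_univ_eq_sum_range (fun i ↦ (m + i) / n), Nat.sum_range_add_div hn]
  have hcS (i : Fin n) : c i < S.card := by
    have : (m + i) / n < S.card - n + 1 := by
      rw [Nat.div_lt_iff_lt_mul hn]
      have := i.isLt
      nlinarith
    have := i.isLt
    rw [hc]
    omega
  have hdiff (i j : Fin n) (hij : i < j) : c i < c j ∧ c j - c i < p := by
    have hij' : (i : ℕ) < j := hij
    have h1 : (m + i) / n ≤ (m + j) / n := Nat.div_le_div_right (by omega)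
    have h2 : (m + j) / n ≤ (m + i) / n + 1 := by
      rw [← Nat.add_div_right _ hn]
      exact Nat.div_le_div_right (by omega)
    rw [hc, hc]
    omega
  refine lt_card_image_sum_powersetCard_of_coeff_ne_zero S hcS hdeg
    (right_ne_zero_of_mul (a := ∏ i, ((c i).factorial : F)) ?_)
  rw [MvPolynomial.prod_factorial_mul_coeff_det_vandermonde_X_mul_sum_X_pow F hdeg]
  refine mul_ne_zero ?_ ?_
  · rw [Ne, CharP.cast_eq_zero_iff F p, (Fact.out : p.Prime).dvd_factorial]
    omega
  · rw [Matrix.det_vandermonde, prod_ne_zero_iff]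
    intro i _
    rw [prod_ne_zero_iff]
    intro j hj
    obtain ⟨h1, h2⟩ := hdiff i j (mem_Ioi.mp hj)
    rw [← Nat.cast_sub h1.le, Ne, CharP.cast_eq_zero_iff F p]
    exact Nat.not_dvd_of_pos_of_lt (by omega) h2

/-- Removing elements `U` from `S` and forcing them into each sum gives fewer sums. -/
theorem Finset.card_image_sum_powersetCard_sdiff_le {M : Type*} [AddCommGroup M] [DecidableEq M]
    {S U : Finset M} (hU : U ⊆ S) (k : ℕ) :
    (((S \ U).powersetCard k).image (fun T => T.sum id)).card ≤
      ((S.powersetCard (k + U.card)).image (fun T => T.sum id)).card := by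
  refine card_le_card_of_injOn (· + U.sum id) ?_ (add_left_injective _).injOn
  intro x hx
  obtain ⟨T, hT, rfl⟩ := mem_image.mp hx
  obtain ⟨hTS, hTk⟩ := mem_powersetCard.mp hT
  have hdisj : Disjoint T U := disjoint_of_subset_left hTS sdiff_disjoint
  refine mem_image.mpr ⟨T ∪ U, mem_powersetCard.mpr ⟨?_, ?_⟩, sum_union hdisj⟩
  · exact union_subset (hTS.trans sdiff_subset) hU
  · rw [card_union_of_disjoint hdisj, hTk]

/-- The Dias da Silva–Hamidoune theorem (Erdős–Heilbronn conjecture): in a field of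
characteristic `p > 0`, the set of sums of `n` distinct elements of a finite set `S`
has at least `min p (n * |S| - n² + 1)` elements. -/
theorem stmt4 {F : Type*} [Field F] [DecidableEq F] (p : ℕ) [CharP F p] (hp : 0 < p)
    (S : Finset F) (n : ℕ) (hn : 0 < n) :
    min (p : ℤ) ((n : ℤ) * S.card - (n : ℤ) ^ 2 + 1) ≤
      (((S.powersetCard n).image (fun T => T.sum id)).card : ℤ) := by
  have : NeZero p := ⟨hp.ne'⟩
  have hpp : Fact p.Prime := CharP.char_is_prime_of_pos F p
  have hp2 := hpp.out.two_le
  rcases lt_or_ge S.card n with hlt | hle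
  · refine (min_le_right _ _).trans ((?_ : _ ≤ (0 : ℤ)).trans (by positivity))
    nlinarith
  obtain ⟨k, hk⟩ := Nat.exists_eq_add_of_le hle
  have hval : (n : ℤ) * S.card - (n : ℤ) ^ 2 + 1 = (n * k : ℕ) + 1 := by
    rw [hk]
    push_cast
    ring
  rw [hval]
  rcases lt_or_ge n p with hnp | hpn
  · have h := Finset.lt_card_image_sum_powersetCard p S (m := min (p - 1) (n * k)) hn hle hnp
      (by omega) (by rw [hk, Nat.add_sub_cancel_left]; exact min_le_right _ _)
    omega
  · rcases Nat.eq_zero_or_pos k with rfl | hk0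
    · have : 0 < ((S.powersetCard n).image (fun T => T.sum id)).card :=
        Finset.card_pos.mpr ((Finset.powersetCard_nonempty.mpr hle).image _)
      rw [mul_zero]
      omega
    · obtain ⟨U, hUS, hU⟩ := Finset.exists_subset_card_eq (show n - (p - 1) ≤ S.card by omega)
      have hcard : (S \ U).card = p - 1 + k := by
        rw [Finset.card_sdiff_of_subset hUS]
        omega
      have h1 := Finset.card_image_sum_powersetCard_sdiff_le hUS (p - 1)
      rw [hU, Nat.add_sub_cancel' (by omega)] at h1
      have h2 := Finset.lt_card_image_sum_powersetCard p (S \ U) (m := p - 1) (n := p - 1)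
        (by omega) (by omega) (by omega) (by omega)
        (by rw [hcard, Nat.add_sub_cancel_left]; exact Nat.le_mul_of_pos_right _ hk0)
      omega
end

section
/- Let q be an odd prime power and 3 ≤ k < (√q + 1)/4. Then u ∈ F_q^{q-1} is a deep hole of the primitive Reed-Solomon code RS_q(F_q^*, k) if and only if its Lagrange interpolating polynomial satisfies u(x) = a·x^k + f(x) with a ≠ 0, or u(x) = b·x^{q-2} + f(x) with b ≠ 0, where deg f ≤ k-1. -/
/-- Error distance of a word `u` to a code `C`. -/
noncomputable def errDist {ι F : Type*} [Fintype ι] [DecidableEq F]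
    (u : ι → F) (C : Set (ι → F)) : ℕ :=
  sInf ((fun c => hammingDist u c) '' C)

/-- The Reed-Solomon code with evaluation set `D` and dimension `k`. -/
noncomputable def RSCode {F : Type*} [Field F] (D : Finset F) (k : ℕ) : Set (D → F) :=
  {v | ∃ f : Polynomial F, f.degree < k ∧ ∀ α : D, v α = f.eval (α : F)}

section
open MvPolynomial
open scoped TensorProduct

theorem finrank_restrictTotalDegree_fin_two {F : Type*} [Field F] (n : ℕ) :
    2 * Module.finrank F (restrictTotalDegree (Fin 2) F n) = (n + 1) * (n + 2) := by
  have key (m : Fin 2 →₀ ℕ) : (m.sum fun _ e => e) = m 0 + m 1 := by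
    rw [Finsupp.sum_fintype _ _ (by simp), Fin.sum_univ_two]
  have e : {m : Fin 2 →₀ ℕ | (m.sum fun _ e => e) ≤ n} ≃
      (Finset.range (n + 1)).sigma fun i => Finset.range (n + 1 - i) :=
    { toFun := fun m => ⟨⟨m.1 0, m.1 1⟩, by
        have : (m.1.sum fun _ e => e) ≤ n := m.2
        rw [key] at this
        simp only [Finset.mem_sigma, Finset.mem_range]; omega⟩
      invFun := fun p => ⟨Finsupp.equivFunOnFinite.symm ![p.1.1, p.1.2], by
        have := p.2
        simp only [Finset.mem_sigma, Finset.mem_range] at this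
        change (Finsupp.sum _ _) ≤ n
        rw [key]; simp; omega⟩
      left_inv := fun m => by ext i; fin_cases i <;> simp
      right_inv := fun p => by simp }
  have h : Module.finrank F (restrictTotalDegree (Fin 2) F n) =
      Nat.card {m : Fin 2 →₀ ℕ | (m.sum fun _ e => e) ≤ n} :=
    Module.finrank_eq_nat_card_basis (basisRestrictSupport F _)
  rw [h, Nat.card_congr e, Nat.card_eq_fintype_card, Fintype.card_coe, Finset.card_sigma]
  simp only [Finset.card_range]
  have := Finset.sum_range_reflect (fun i => i + 1) (n + 1)
  rw [show ∑ x ∈ Finset.range (n + 1), (n + 1 - x) = ∑ j ∈ Finset.range (n + 1), (j + 1) by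
    rw [← this]; exact Finset.sum_congr rfl fun i hi => by
      have := Finset.mem_range.1 hi; omega]
  clear h this e
  induction n with
  | zero => simp
  | succ n ih => rw [Finset.sum_range_succ, mul_add, ih]; ring

theorem totalDegree_polynomial_aeval_X_le {σ F : Type*} [Field F] (i : σ) (p : Polynomial F) :
    (Polynomial.aeval (X i : MvPolynomial σ F) p).totalDegree ≤ p.natDegree := by
  rw [Polynomial.aeval_eq_sum_range]
  refine totalDegree_finsetSum_le fun j hj => ?_
  refine (totalDegree_smul_le _ _).trans ((totalDegree_X_pow _ _).le.trans ?_)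
  have := Finset.mem_range.1 hj; omega

theorem exists_totalDegree_le_eval_eq {F : Type*} [Field F] (v : F → F) (T : Finset F)
    (f : F → F) : ∃ p : MvPolynomial (Fin 2) F, p.totalDegree ≤ T.card ∧
      ∀ a ∈ T, eval ![a, v a] p = f a := by
  classical
  refine ⟨Polynomial.aeval (X 0) (Lagrange.interpolate T id f),
    (totalDegree_polynomial_aeval_X_le _ _).trans ?_, fun a ha => ?_⟩
  · exact Polynomial.natDegree_le_of_degree_le
      (Lagrange.degree_interpolate_lt f (Function.injective_id.injOn)).le
  · have h := Lagrange.eval_interpolate_at_node f (s := T) (v := id)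
      (Function.injective_id.injOn) ha
    conv_rhs => rw [← h]
    rw [← aeval_eq_eval, ← Polynomial.aeval_algHom_apply]
    simp [Polynomial.eval_finsetSum]

/-- Bézout's bound for the points of a function graph. -/
theorem card_le_of_irreducible_of_not_dvd {F : Type*} [Field F] (v : F → F) (T : Finset F)
    {φ ψ : MvPolynomial (Fin 2) F} (hφ : Prime φ) (h : ¬ φ ∣ ψ) {m : ℕ} (hm : ψ.totalDegree ≤ m)
    (h1 : ∀ a ∈ T, eval ![a, v a] φ = 0) (h2 : ∀ a ∈ T, eval ![a, v a] ψ = 0) :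
    T.card ≤ φ.totalDegree * m := by
  classical
  set d := φ.totalDegree with hd
  set s := T.card with hs
  let V := restrictTotalDegree (Fin 2) F
  have hψ0 : ψ ≠ 0 := fun h0 => h (h0 ▸ dvd_zero _)
  let Φ : (V (m + s) × V (d + s)) →ₗ[F] MvPolynomial (Fin 2) F :=
    ((LinearMap.mulLeft F φ).comp (V (m + s)).subtype).coprod
      ((LinearMap.mulLeft F ψ).comp (V (d + s)).subtype)
  have hΦ (x) : Φ x = φ * x.1 + ψ * x.2 := rfl
  let ev : V (d + m + s) →ₗ[F] (T → F) :=
    { toFun := fun p a => eval ![a.1, v a.1] p.1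
      map_add' := fun p q => by ext; simp
      map_smul' := fun c p => by ext; simp }
  have hev : Function.Surjective ev := fun f => by
    obtain ⟨p, hp, hp'⟩ := exists_totalDegree_le_eval_eq v T
      (fun a => if ha : a ∈ T then f ⟨a, ha⟩ else 0)
    refine ⟨⟨p, (mem_restrictTotalDegree _ _ _).2 (by omega)⟩, ?_⟩
    ext a
    exact (hp' a.1 a.2).trans (by simp)
  have r1 := LinearMap.finrank_range_add_finrank_ker ev
  rw [LinearMap.range_eq_top.2 hev, finrank_top, Module.finrank_fintype_fun_eq_card,
    Fintype.card_coe] at r1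
  have r2 := LinearMap.finrank_range_add_finrank_ker Φ
  rw [Module.finrank_prod] at r2
  have r3 : Module.finrank F Φ.range ≤ Module.finrank F ev.ker := by
    rw [← Submodule.finrank_map_subtype_eq]
    refine Submodule.finrank_mono ?_
    rintro _ ⟨⟨α, β⟩, rfl⟩
    have hα := (mem_restrictTotalDegree _ _ _).1 α.2
    have hβ := (mem_restrictTotalDegree _ _ _).1 β.2
    have hmem : Φ (α, β) ∈ V (d + m + s) := by
      rw [mem_restrictTotalDegree, hΦ]
      refine (totalDegree_add _ _).trans (max_le ?_ ?_)
      · exact (totalDegree_mul _ _).trans (by simp only; omega)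
      · exact (totalDegree_mul _ _).trans (by simp only; omega)
    refine ⟨⟨_, hmem⟩, ?_, rfl⟩
    ext a
    change eval _ (Φ (α, β)) = 0
    rw [hΦ, map_add, map_mul, map_mul, h1 _ a.2, h2 _ a.2]; simp
  have r4 : Module.finrank F Φ.ker ≤ Module.finrank F (V s) := by
    have hex (x : Φ.ker) : ∃ w : V s, x.1.2.1 = φ * w.1 := by
      obtain ⟨⟨α, β⟩, hx⟩ := x
      have hx : φ * α.1 + ψ * β.1 = 0 := hx
      have hdvd : φ ∣ ψ * β.1 := ⟨-α.1, by linear_combination hx⟩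
      obtain ⟨w, hw⟩ := (hφ.dvd_or_dvd hdvd).resolve_left h
      refine ⟨⟨w, ?_⟩, hw⟩
      rw [mem_restrictTotalDegree]
      by_cases hw0 : w = 0
      · simp [hw0]
      have := (mem_restrictTotalDegree _ _ _).1 β.2
      rw [hw, totalDegree_mul_of_isDomain hφ.ne_zero hw0] at this
      omega
    choose w hw using hex
    have hadd : ∀ x y, w (x + y) = w x + w y := fun x y => by
      apply Subtype.ext
      apply mul_left_cancel₀ hφ.ne_zero
      rw [← hw]
      change x.1.2.1 + y.1.2.1 = φ * ((w x).1 + (w y).1)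
      rw [mul_add, ← hw, ← hw]
    have hsm : ∀ (c : F) x, w (c • x) = c • w x := fun c x => by
      apply Subtype.ext
      apply mul_left_cancel₀ hφ.ne_zero
      rw [← hw]
      change c • x.1.2.1 = φ * (c • (w x).1)
      rw [hw]; simp
    refine LinearMap.finrank_le_finrank_of_injective (f :=
      { toFun := w, map_add' := hadd, map_smul' := hsm }) ?_
    rw [injective_iff_map_eq_zero]
    intro x hx
    have hx0 : w x = 0 := hx
    have hb : x.1.2.1 = 0 := by rw [hw, hx0]; simp
    have hxx : φ * x.1.1.1 + ψ * x.1.2.1 = 0 := x.2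
    rw [hb, mul_zero, add_zero] at hxx
    have ha := (mul_eq_zero.1 hxx).resolve_left hφ.ne_zero
    apply Subtype.ext
    exact Prod.ext (Subtype.ext ha) (Subtype.ext hb)
  have d1 := finrank_restrictTotalDegree_fin_two (F := F) (d + m + s)
  have d2 := finrank_restrictTotalDegree_fin_two (F := F) (m + s)
  have d3 := finrank_restrictTotalDegree_fin_two (F := F) (d + s)
  have d4 := finrank_restrictTotalDegree_fin_two (F := F) s
  simp only [V] at r1 r2 r3 r4
  zify at *
  nlinarith

/-- Bi-polynomials on the affine plane of bidegree at most `(n, n)`. -/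
noncomputable def biPoly (F : Type*) [Field F] (n : ℕ) :
    Submodule F (MvPolynomial (Fin 2) F ⊗[F] MvPolynomial (Fin 2) F) :=
  Submodule.span F {x | ∃ p q : MvPolynomial (Fin 2) F,
    p.totalDegree ≤ n ∧ q.totalDegree ≤ n ∧ x = p ⊗ₜ q}

/-- Evaluation of a bi-polynomial at a pair of points of the plane. -/
noncomputable def biEval (F : Type*) {B : Type*} [Field F] [CommRing B] [Algebra F B]
    (X Y : Fin 2 → B) :
    MvPolynomial (Fin 2) F ⊗[F] MvPolynomial (Fin 2) F →ₐ[F] B :=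
  Algebra.TensorProduct.productMap (aeval X) (aeval Y)

section
variable {F : Type*} [Field F]

theorem biEval_tmul {B : Type*} [CommRing B] [Algebra F B] (X Y : Fin 2 → B)
    (p q : MvPolynomial (Fin 2) F) : biEval F X Y (p ⊗ₜ q) = aeval X p * aeval Y q := by
  simp [biEval]

theorem biEval_comp {B B' : Type*} [CommRing B] [Algebra F B] [CommRing B'] [Algebra F B']
    (g : B →ₐ[F] B') (X Y : Fin 2 → B) (E : MvPolynomial (Fin 2) F ⊗[F] MvPolynomial (Fin 2) F) :
    g (biEval F X Y E) = biEval F (fun i => g (X i)) (fun i => g (Y i)) E := by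
  have : g.comp (biEval F X Y) = biEval F (fun i => g (X i)) (fun i => g (Y i)) := by
    ext <;> simp [biEval]
  rw [← this]; rfl

theorem tmul_mem_biPoly {n : ℕ} {p q : MvPolynomial (Fin 2) F} (hp : p.totalDegree ≤ n)
    (hq : q.totalDegree ≤ n) : p ⊗ₜ[F] q ∈ biPoly F n :=
  Submodule.subset_span ⟨p, q, hp, hq, rfl⟩

theorem mul_mem_biPoly {n m : ℕ} {x y : MvPolynomial (Fin 2) F ⊗[F] MvPolynomial (Fin 2) F}
    (hx : x ∈ biPoly F n) (hy : y ∈ biPoly F m) : x * y ∈ biPoly F (n + m) := by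
  have : biPoly F n * biPoly F m ≤ biPoly F (n + m) := by
    rw [biPoly, biPoly, Submodule.span_mul_span, Submodule.span_le]
    rintro _ ⟨_, ⟨p, q, hp, hq, rfl⟩, _, ⟨p', q', hp', hq', rfl⟩, rfl⟩
    simp only [Algebra.TensorProduct.tmul_mul_tmul]
    exact tmul_mem_biPoly ((totalDegree_mul _ _).trans (add_le_add hp hp'))
      ((totalDegree_mul _ _).trans (add_le_add hq hq'))
  exact this (Submodule.mul_mem_mul hx hy)

theorem pow_mem_biPoly {n m : ℕ} {x : MvPolynomial (Fin 2) F ⊗[F] MvPolynomial (Fin 2) F}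
    (hx : x ∈ biPoly F n) : x ^ m ∈ biPoly F (m * n) := by
  induction m with
  | zero => rw [pow_zero]; exact tmul_mem_biPoly (by simp) (by simp)
  | succ m ih => rw [pow_succ, add_mul, one_mul]; exact mul_mem_biPoly ih hx

theorem mem_biPoly_iff {n : ℕ} {x : MvPolynomial (Fin 2) F ⊗[F] MvPolynomial (Fin 2) F} :
    x ∈ biPoly F n ↔ ∃ (N : ℕ) (p q : Fin N → MvPolynomial (Fin 2) F),
      (∀ i, (p i).totalDegree ≤ n) ∧ (∀ i, (q i).totalDegree ≤ n) ∧ x = ∑ i, p i ⊗ₜ q i := by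
  constructor
  · intro hx
    obtain ⟨N, f, g, rfl⟩ := (Submodule.mem_span_set' ..).1 hx
    choose p q hp hq h using fun i => (g i).2
    refine ⟨N, fun i => f i • p i, q, fun i => (totalDegree_smul_le _ _).trans (hp i), hq, ?_⟩
    simp [h, TensorProduct.smul_tmul']
  · rintro ⟨N, p, q, hp, hq, rfl⟩
    exact Submodule.sum_mem _ fun i _ => tmul_mem_biPoly (hp i) (hq i)

/-- A bi-polynomial vanishing on `S × S` vanishes at all pairs of generalized points on which
every polynomial vanishing on `S` vanishes. -/
theorem biEval_eq_zero_of_forall {B : Type*} [CommRing B] [Algebra F B] {n : ℕ}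
    (S : Set (Fin 2 → F)) {E : MvPolynomial (Fin 2) F ⊗[F] MvPolynomial (Fin 2) F}
    (hE : E ∈ biPoly F n) (h : ∀ x ∈ S, ∀ y ∈ S, biEval F x y E = 0) (X Y : Fin 2 → B)
    (hX : ∀ ψ : MvPolynomial (Fin 2) F, ψ.totalDegree ≤ n → (∀ x ∈ S, eval x ψ = 0) →
      aeval X ψ = 0)
    (hY : ∀ ψ : MvPolynomial (Fin 2) F, ψ.totalDegree ≤ n → (∀ x ∈ S, eval x ψ = 0) →
      aeval Y ψ = 0) : biEval F X Y E = 0 := by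
  classical
  obtain ⟨N, p, q, hp, hq, rfl⟩ := mem_biPoly_iff.1 hE
  simp only [map_sum, biEval_tmul, aeval_eq_eval] at h ⊢
  have h1 : ∀ y ∈ S, ∑ i, eval y (q i) • aeval X (p i) = 0 := fun y hy => by
    have := hX (∑ i, eval y (q i) • p i)
      (totalDegree_finsetSum_le fun i _ => (totalDegree_smul_le _ _).trans (hp i))
      (fun x hx => by
        rw [← h x hx y hy, map_sum]
        exact Finset.sum_congr rfl fun i _ => by rw [smul_eval, mul_comm])
    simpa using this
  have h2 : ∀ ℓ : B →ₗ[F] F, ∑ i, ℓ (aeval X (p i)) • aeval Y (q i) = 0 := fun ℓ => by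
    have := hY (∑ i, ℓ (aeval X (p i)) • q i)
      (totalDegree_finsetSum_le fun i _ => (totalDegree_smul_le _ _).trans (hq i))
      (fun y hy => by
        have := congrArg ℓ (h1 y hy)
        rw [map_zero, map_sum] at this
        rw [← this, map_sum]
        exact Finset.sum_congr rfl fun i _ => by rw [smul_eval, map_smul, smul_eq_mul, mul_comm])
    simpa using this
  let b := Module.Basis.ofVectorSpace F B
  let J := Finset.univ.biUnion fun i => (b.repr (aeval X (p i))).support
  have h3 (i) : aeval X (p i) = ∑ j ∈ J, b.coord j (aeval X (p i)) • b j := by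
    conv_lhs => rw [← b.linearCombination_repr (aeval X (p i)), Finsupp.linearCombination_apply]
    exact Finsupp.sum_of_support_subset _
      (Finset.subset_biUnion_of_mem (fun i => (b.repr (aeval X (p i))).support)
        (Finset.mem_univ i)) _ (by simp)
  calc ∑ i, aeval X (p i) * aeval Y (q i)
      = ∑ i, ∑ j ∈ J, b j * (b.coord j (aeval X (p i)) • aeval Y (q i)) := by
        refine Finset.sum_congr rfl fun i _ => ?_
        conv_lhs => rw [h3 i, Finset.sum_mul]
        exact Finset.sum_congr rfl fun j _ => by simp
    _ = ∑ j ∈ J, b j * ∑ i, b.coord j (aeval X (p i)) • aeval Y (q i) := by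
        rw [Finset.sum_comm]; simp_rw [Finset.mul_sum]
    _ = 0 := Finset.sum_eq_zero fun j _ => by rw [h2 (b.coord j), mul_zero]
end

/-- The point of the graph of `v` over `a`. -/
def graphPt {F : Type*} (v : F → F) (a : F) : Fin 2 → F := ![a, v a]

/-- The slope of the chord of the graph of `v` between `a` and `x`. -/
def chordSlope {F : Type*} [Field F] (v : F → F) (a x : F) : F := (v x - v a) / (x - a)

/-- The slopes of the non-vertical lines through `(a, v a)` meeting the graph of `v` over `D`
only in `(a, v a)`. -/
def tangentSlopes {F : Type*} [Field F] [Fintype F] [DecidableEq F] (D : Finset F) (v : F → F)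
    (a : F) : Finset F := Finset.univ \ (D.erase a).image (chordSlope v a)

/-- The normalized product of the tangent lines at `(a, v a)`. -/
noncomputable def tangentPoly {F : Type*} [Field F] [Fintype F] [DecidableEq F] (D : Finset F)
    (v : F → F) (a : F) : MvPolynomial (Fin 2) F :=
  C (∏ c ∈ Dᶜ, (a - c)) *
    ∏ m ∈ tangentSlopes D v a, ((X 1 - C (v a)) - C m * (X 0 - C a))

/-- No three points of the graph of `v` over `D` are collinear. -/
def IsGraphArc {F : Type*} [Field F] (D : Finset F) (v : F → F) : Prop :=
  ∀ a ∈ D, ∀ b ∈ D, ∀ c ∈ D, a ≠ b → a ≠ c → b ≠ c →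
    (v b - v a) * (c - a) ≠ (v c - v a) * (b - a)

@[simp] theorem graphPt_zero {F : Type*} (v : F → F) (a : F) : graphPt v a 0 = a := rfl
@[simp] theorem graphPt_one {F : Type*} (v : F → F) (a : F) : graphPt v a 1 = v a := rfl

section
variable {F : Type*} [Field F] [Fintype F] [DecidableEq F]

theorem prod_erase_zero_eq_neg_one : ∏ x ∈ Finset.univ.erase (0 : F), x = -1 := by
  have h := FiniteField.prod_univ_units_id_eq_neg_one (K := F)
  have h2 := congrArg (fun u : Fˣ => (u : F)) h
  simp only [Units.coe_prod, Units.val_neg, Units.val_one] at h2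
  rw [← h2]
  symm
  refine Finset.prod_bij (fun u _ => (u : F)) (by simp) (fun _ _ _ _ h => Units.ext h)
    (fun b hb => ⟨Units.mk0 b (by simpa using hb), by simp, by simp⟩) (by simp)

theorem prod_erase_sub_eq_neg_one (a : F) : ∏ x ∈ Finset.univ.erase a, (x - a) = -1 := by
  rw [← prod_erase_zero_eq_neg_one (F := F)]
  refine Finset.prod_bij (fun x _ => x - a) (fun x hx => ?_) (fun _ _ _ _ h => by simpa using h)
    (fun b hb => ⟨b + a, ?_, by simp⟩) (by simp)
  · simpa [sub_eq_zero] using hx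
  · simpa using hb

variable {D : Finset F} {v : F → F}

theorem chordSlope_injOn {F : Type*} [Field F] [DecidableEq F] {D : Finset F} {v : F → F}
    (hv : IsGraphArc D v) {a : F} (ha : a ∈ D) :
    Set.InjOn (chordSlope v a) (D.erase a : Finset F) := by
  intro x hx y hy h
  simp only [Finset.coe_erase, Set.mem_sdiff, Finset.mem_coe, Set.mem_singleton_iff] at hx hy
  by_contra hxy
  refine hv a ha x hx.1 y hy.1 (Ne.symm hx.2) (Ne.symm hy.2) hxy ?_
  have h1 := sub_ne_zero.2 hx.2
  have h2 := sub_ne_zero.2 hy.2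
  simp only [chordSlope] at h
  field_simp at h
  linear_combination h

theorem card_tangentSlopes (hv : IsGraphArc D v) {t : ℕ} (hD : D.card + t = Fintype.card F + 1)
    {a : F} (ha : a ∈ D) : (tangentSlopes D v a).card = t := by
  rw [tangentSlopes, Finset.card_sdiff_of_subset (Finset.subset_univ _),
    Finset.card_image_of_injOn (chordSlope_injOn hv ha), Finset.card_erase_of_mem ha,
    Finset.card_univ]
  have := Finset.card_pos.2 ⟨a, ha⟩
  have : D.card ≤ Fintype.card F := Finset.card_le_univ D
  omega

theorem aeval_tangentPoly {B : Type*} [CommRing B] [Algebra F B] (a : F) (Y : Fin 2 → B) :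
    aeval Y (tangentPoly D v a) = algebraMap F B (∏ c ∈ Dᶜ, (a - c)) *
      ∏ m ∈ tangentSlopes D v a, ((Y 1 - algebraMap F B (v a)) -
        algebraMap F B m * (Y 0 - algebraMap F B a)) := by
  simp only [tangentPoly, map_mul, map_prod, map_sub, aeval_X, algHom_C]

theorem totalDegree_tangentPoly_le (a : F) :
    (tangentPoly D v a).totalDegree ≤ (tangentSlopes D v a).card := by
  refine (totalDegree_mul _ _).trans ?_
  rw [totalDegree_C, zero_add]
  refine (totalDegree_finsetProd _ _).trans ?_
  rw [Finset.card_eq_sum_ones]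
  refine Finset.sum_le_sum fun m _ => ?_
  refine (totalDegree_sub _ _).trans (max_le ?_ ?_)
  · exact (totalDegree_sub _ _).trans (max_le (totalDegree_X _).le (by simp))
  · refine (totalDegree_mul _ _).trans ?_
    rw [totalDegree_C, zero_add]
    exact (totalDegree_sub _ _).trans (max_le (totalDegree_X _).le (by simp))

theorem aeval_tangentPoly_homothety (hv : IsGraphArc D v) {t : ℕ}
    (hD : D.card + t = Fintype.card F + 1) {B : Type*} [CommRing B] [Algebra F B] {a : F}
    (ha : a ∈ D) (l : B) (Y : Fin 2 → B) :
    aeval (fun i => algebraMap F B (graphPt v a i) + l * (Y i - algebraMap F B (graphPt v a i)))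
      (tangentPoly D v a) = l ^ t * aeval Y (tangentPoly D v a) := by
  rw [aeval_tangentPoly, aeval_tangentPoly, ← card_tangentSlopes hv hD ha, mul_left_comm,
    ← Finset.prod_const, ← Finset.prod_mul_distrib]
  congr 1
  refine Finset.prod_congr rfl fun m _ => ?_
  simp; ring

theorem eval_tangentPoly_mul (hv : IsGraphArc D v) {a b : F} (ha : a ∈ D) (hb : b ∈ D)
    (hab : a ≠ b) : eval (graphPt v b) (tangentPoly D v a) * ((-1) ^ Dᶜ.card *
      (∏ x ∈ (D.erase a).erase b, ((v b - v a) * (x - a) - (v x - v a) * (b - a))) *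
        (b - a)) = 1 := by
  have hba : b - a ≠ 0 := sub_ne_zero.2 hab.symm
  have hbD : b ∈ D.erase a := Finset.mem_erase.2 ⟨hab.symm, hb⟩
  -- the product over all slopes other than the one of the chord
  have h1 : ∏ m ∈ Finset.univ.erase (chordSlope v a b), ((v b - v a) - m * (b - a)) = -1 := by
    rw [← prod_erase_zero_eq_neg_one (F := F)]
    refine Finset.prod_bij (fun m _ => (v b - v a) - m * (b - a)) (fun m hm => ?_)
      (fun m _ m' _ h => ?_) (fun y hy => ⟨((v b - v a) - y) / (b - a), ?_, ?_⟩) (fun _ _ => rfl)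
    · simp only [Finset.mem_erase, Finset.mem_univ, and_true] at hm ⊢
      intro h0
      exact hm (by rw [chordSlope, eq_div_iff hba]; linear_combination -h0)
    · exact mul_right_cancel₀ hba (by linear_combination -h)
    · simp only [Finset.mem_erase, Finset.mem_univ, and_true] at hy ⊢
      rw [chordSlope, Ne, div_left_inj' hba]
      intro h; exact hy (by linear_combination -h)
    · field_simp; ring
  have h2 : Finset.univ.erase (chordSlope v a b) = tangentSlopes D v a ∪
      ((D.erase a).erase b).image (chordSlope v a) := by
    ext m
    simp only [Finset.mem_erase, Finset.mem_univ, and_true, tangentSlopes, Finset.mem_union,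
      Finset.mem_sdiff, Finset.mem_image, true_and]
    constructor
    · intro hm
      by_cases h : ∃ x, (x ≠ a ∧ x ∈ D) ∧ chordSlope v a x = m
      · obtain ⟨x, hx, rfl⟩ := h
        exact Or.inr ⟨x, ⟨fun h => hm (h ▸ rfl), hx⟩, rfl⟩
      · exact Or.inl h
    · rintro (h | ⟨x, hx, rfl⟩) h'
      · exact h ⟨b, ⟨hab.symm, hb⟩, h'.symm⟩
      · exact hx.1 (chordSlope_injOn hv ha (Finset.mem_coe.2 (Finset.mem_erase.2 hx.2))
          (Finset.mem_coe.2 hbD) h')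
  have h3 : Disjoint (tangentSlopes D v a) (((D.erase a).erase b).image (chordSlope v a)) := by
    rw [tangentSlopes]
    exact Finset.disjoint_of_subset_right (Finset.image_subset_image (Finset.erase_subset _ _))
      Finset.sdiff_disjoint
  rw [h2, Finset.prod_union h3, Finset.prod_image (fun x hx y hy h => chordSlope_injOn hv ha
    (Finset.mem_of_mem_erase hx) (Finset.mem_of_mem_erase hy) h)] at h1
  have h4 : (∏ x ∈ (D.erase a).erase b, ((v b - v a) - chordSlope v a x * (b - a))) *
      ∏ x ∈ (D.erase a).erase b, (x - a) =
      ∏ x ∈ (D.erase a).erase b, ((v b - v a) * (x - a) - (v x - v a) * (b - a)) := by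
    rw [← Finset.prod_mul_distrib]
    refine Finset.prod_congr rfl fun x hx => ?_
    have : x - a ≠ 0 := sub_ne_zero.2 (by simp at hx; exact hx.2.1)
    rw [chordSlope]; field_simp
  have h5 := prod_erase_sub_eq_neg_one a
  have h6 : Finset.univ.erase a = D.erase a ∪ Dᶜ := by
    ext x
    simp only [Finset.mem_erase, Finset.mem_univ, and_true, Finset.mem_union, Finset.mem_compl]
    by_cases hx : x ∈ D
    · simp [hx]
    · simp only [hx, and_false, not_false_eq_true, or_true, iff_true]
      rintro rfl; exact hx ha
  rw [h6, Finset.prod_union (Finset.disjoint_of_subset_left (Finset.erase_subset _ _)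
    disjoint_compl_right), ← Finset.mul_prod_erase _ _ hbD] at h5
  have h7 : ∏ x ∈ Dᶜ, (x - a) = (-1) ^ Dᶜ.card * ∏ c ∈ Dᶜ, (a - c) := by
    rw [← Finset.prod_const, ← Finset.prod_mul_distrib]
    exact Finset.prod_congr rfl fun x _ => by ring
  rw [h7] at h5
  have h8 : eval (graphPt v b) (tangentPoly D v a) = (∏ c ∈ Dᶜ, (a - c)) *
      ∏ m ∈ tangentSlopes D v a, ((v b - v a) - m * (b - a)) := by
    rw [← aeval_eq_eval, aeval_tangentPoly]; simp
  rw [h8, ← h4]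
  linear_combination (∏ c ∈ Dᶜ, (a - c)) * (-1) ^ Dᶜ.card *
    (∏ x ∈ (D.erase a).erase b, (x - a)) * (b - a) * h1 - h5

theorem eval_tangentPoly_ne_zero (hv : IsGraphArc D v) {a b : F} (ha : a ∈ D) (hb : b ∈ D)
    (hab : a ≠ b) : eval (graphPt v b) (tangentPoly D v a) ≠ 0 := fun h => by
  have := eval_tangentPoly_mul hv ha hb hab
  simp [h] at this

theorem eval_tangentPoly_self (hv : IsGraphArc D v) {t : ℕ}
    (hD : D.card + t = Fintype.card F + 1) (ht : t ≠ 0) {a : F} (ha : a ∈ D) :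
    eval (graphPt v a) (tangentPoly D v a) = 0 := by
  have h := aeval_tangentPoly_homothety hv hD ha (0 : F) (graphPt v a)
  simpa [ht, aeval_eq_eval] using h

/-- Segre's lemma of tangents. -/
theorem eval_tangentPoly_comm (hq : Odd (Fintype.card F)) (hv : IsGraphArc D v) {t : ℕ}
    (hD : D.card + t = Fintype.card F + 1) (ht : t ≠ 0) {a b : F} (ha : a ∈ D) (hb : b ∈ D) :
    eval (graphPt v b) (tangentPoly D v a) =
      (-1) ^ (t + 1) * eval (graphPt v a) (tangentPoly D v b) := by
  obtain rfl | hab := eq_or_ne a b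
  · simp [eval_tangentPoly_self hv hD ht ha]
  have h1 := eval_tangentPoly_mul hv ha hb hab
  have h2 := eval_tangentPoly_mul hv hb ha hab.symm
  rw [Finset.erase_right_comm] at h2
  have h3 : ∏ x ∈ (D.erase a).erase b, ((v a - v b) * (x - b) - (v x - v b) * (a - b)) =
      (-1) ^ ((D.erase a).erase b).card *
      ∏ x ∈ (D.erase a).erase b, ((v b - v a) * (x - a) - (v x - v a) * (b - a)) := by
    rw [← Finset.prod_const, ← Finset.prod_mul_distrib]
    exact Finset.prod_congr rfl fun x _ => by ring
  have hcard : ((D.erase a).erase b).card + 2 = D.card := by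
    rw [Finset.card_erase_of_mem (Finset.mem_erase.2 ⟨hab.symm, hb⟩), Finset.card_erase_of_mem ha]
    have : 1 < D.card := Finset.one_lt_card.2 ⟨a, ha, b, hb, hab⟩
    omega
  have hpar : ((-1 : F)) ^ ((D.erase a).erase b).card = (-1) ^ t := by
    apply neg_one_pow_congr
    obtain ⟨r, hr⟩ := hq
    have : ((D.erase a).erase b).card + t = 2 * r := by omega
    have h' : Even (((D.erase a).erase b).card + t) := ⟨r, by omega⟩
    exact Nat.even_add.1 h'
  rw [h3, hpar] at h2
  set K := ∏ x ∈ (D.erase a).erase b, ((v b - v a) * (x - a) - (v x - v a) * (b - a))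
  have hK : (-1) ^ Dᶜ.card * K * (b - a) ≠ 0 := right_ne_zero_of_mul_eq_one h1
  apply mul_right_cancel₀ hK
  rw [h1]; linear_combination -h2
end

theorem exists_sum_mul_of_rows_mem_of_cols_mem {F ι : Type*} [Field F] [Fintype ι]
    (W : Submodule F (ι → F)) (K : ι → ι → F) (hrow : ∀ a, K a ∈ W)
    (hcol : ∀ b, (fun a => K a b) ∈ W) :
    ∃ (N : ℕ) (f g : Fin N → ι → F), (∀ i, f i ∈ W) ∧ (∀ i, g i ∈ W) ∧
      ∀ a b, K a b = ∑ i, f i a * g i b := by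
  classical
  obtain ⟨p, hp⟩ := W.subtype.exists_leftInverse_of_injective W.ker_subtype
  let w := Module.finBasis F W
  let c := fun i => (w.coord i).comp p
  refine ⟨_, fun i => (w i : ι → F), fun i => ∑ a, c i (Pi.single a 1) • K a, fun i => (w i).2,
    fun i => Submodule.sum_mem _ fun a _ => W.smul_mem _ (hrow a), fun a b => ?_⟩
  have hc (i) : c i (fun a => K a b) = (∑ a, c i (Pi.single a 1) • K a) b := by
    conv_lhs => rw [LinearMap.pi_apply_eq_sum_univ (c i)]
    rw [Finset.sum_apply]
    refine Finset.sum_congr rfl fun a _ => ?_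
    rw [Pi.smul_apply, smul_eq_mul, smul_eq_mul, mul_comm]
    congr 2
    ext j; rw [Pi.single_apply]; exact if_congr eq_comm rfl rfl
  have hp' : p (fun a => K a b) = ⟨_, hcol b⟩ := by
    have := LinearMap.congr_fun hp ⟨_, hcol b⟩
    exact this
  have h := w.sum_repr ⟨_, hcol b⟩
  have h2 := congrFun (congrArg Subtype.val h) a
  simp only at h2
  rw [← h2, AddSubmonoidClass.coe_finsetSum, Finset.sum_apply]
  refine Finset.sum_congr rfl fun i _ => ?_
  rw [mul_comm]
  simp only
  rw [← hc]
  simp only [c, LinearMap.comp_apply, hp']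
  rfl

section
variable {F : Type*} [Field F] [Fintype F] [DecidableEq F] {D : Finset F} {v : F → F}

theorem exists_biPoly_tangentPoly (hq : Odd (Fintype.card F)) (hv : IsGraphArc D v) {t : ℕ}
    (hD : D.card + t = Fintype.card F + 1) (ht : t ≠ 0) :
    ∃ E ∈ biPoly F t, ∀ a ∈ D, ∀ b ∈ D, biEval F (graphPt v a) (graphPt v b) E =
      eval (graphPt v a) (tangentPoly D v b) := by
  let ev : MvPolynomial (Fin 2) F →ₗ[F] (D → F) :=
    { toFun := fun p a => eval (graphPt v a) p
      map_add' := fun p q => by ext; simp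
      map_smul' := fun c p => by ext; simp }
  have hev (p a) : ev p a = eval (graphPt v a) p := rfl
  let W := (restrictTotalDegree (Fin 2) F t).map ev
  have hP (a : D) : tangentPoly D v a ∈ restrictTotalDegree (Fin 2) F t := by
    rw [mem_restrictTotalDegree]
    exact (totalDegree_tangentPoly_le _).trans (card_tangentSlopes hv hD a.2).le
  obtain ⟨N, f, g, hf, hg, h⟩ := exists_sum_mul_of_rows_mem_of_cols_mem W
    (fun a b : D => eval (graphPt v a) (tangentPoly D v b)) (fun a =>
      ⟨(-1 : F) ^ (t + 1) • tangentPoly D v a, Submodule.smul_mem _ _ (hP a), by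
        ext b
        rw [hev, smul_eval, eval_tangentPoly_comm hq hv hD ht b.2 a.2]⟩)
    (fun b => ⟨tangentPoly D v b, hP b, by ext a; rw [hev]⟩)
  choose p hp hpf using hf
  choose r hr hrg using hg
  refine ⟨∑ i, p i ⊗ₜ r i, Submodule.sum_mem _ fun i _ => tmul_mem_biPoly
    ((mem_restrictTotalDegree _ _ _).1 (hp i)) ((mem_restrictTotalDegree _ _ _).1 (hr i)),
    fun a ha b hb => ?_⟩
  have := h ⟨a, ha⟩ ⟨b, hb⟩
  simp only at this
  rw [this, map_sum]
  refine Finset.sum_congr rfl fun i _ => ?_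
  rw [biEval_tmul, aeval_eq_eval, aeval_eq_eval, ← hpf, ← hrg, hev, hev]
end

theorem aeval_mul_left_of_isHomogeneous {σ R B : Type*} [CommRing R] [CommRing B]
    [Algebra R B] {φ : MvPolynomial σ R} {n : ℕ} (h : φ.IsHomogeneous n) (c : B) (x : σ → B) :
    aeval (fun i => c * x i) φ = c ^ n * aeval x φ := by
  rw [aeval_def, aeval_def, eval₂_eq, eval₂_eq, Finset.mul_sum]
  refine Finset.sum_congr rfl fun d hd => ?_
  have hdeg : d.degree = n := by
    by_contra hne; exact (mem_support_iff.1 hd) (h.coeff_eq_zero hne)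
  rw [← hdeg, Finsupp.degree, mul_left_comm]
  congr 1
  simp only [mul_pow, Finset.prod_mul_distrib, Finset.prod_pow_eq_pow_sum]
  rfl

theorem exists_isHomogeneous_mul_of_dvd {σ R : Type*} [CommRing R]
    {H L : MvPolynomial σ R} {n : ℕ} (hH : H.IsHomogeneous n) (hL : L.IsHomogeneous 1)
    (hd : L ∣ H) : H = 0 ∨ ∃ r k, k + 1 = n ∧ r.IsHomogeneous k ∧ H = L * r := by
  classical
  obtain ⟨r, rfl⟩ := hd
  have h1 : homogeneousComponent n (L * r) = ∑ j ∈ Finset.range (r.totalDegree + 1),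
      if n = j + 1 then L * homogeneousComponent j r else 0 := by
    conv_lhs => rw [← sum_homogeneousComponent r, Finset.mul_sum, map_sum]
    refine Finset.sum_congr rfl fun j _ => ?_
    have := hL.mul (homogeneousComponent_isHomogeneous j r)
    rw [add_comm] at this
    rw [homogeneousComponent_of_mem this]
  rw [homogeneousComponent_eq_self hH] at h1
  cases n with
  | zero => left; rw [h1]; exact Finset.sum_eq_zero fun j _ => by simp
  | succ n =>
    right
    refine ⟨homogeneousComponent n r, n, rfl, homogeneousComponent_isHomogeneous _ _, ?_⟩
    conv_lhs => rw [h1]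
    simp only [add_left_inj]
    rw [Finset.sum_ite_eq]
    split_ifs with h
    · rfl
    · rw [homogeneousComponent_eq_zero _ _ (by simp at h; omega), mul_zero]

section
variable {F : Type*} [Field F]

theorem linear_dvd_of_isHomogeneous_of_eval_eq_zero {H : MvPolynomial (Fin 2) F} {n : ℕ}
    (hH : H.IsHomogeneous n) {m : F} (hm : eval ![1, m] H = 0) : (X 1 - C m * X 0) ∣ H := by
  have h0 : aeval (![X 0, C m * X 0] : Fin 2 → MvPolynomial (Fin 2) F) H = 0 := by
    have h := aeval_mul_left_of_isHomogeneous hH (X 0 : MvPolynomial (Fin 2) F)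
      (fun i => C (![1, m] i))
    have h2 : aeval (fun i => (C (![1, m] i) : MvPolynomial (Fin 2) F)) H = C (eval ![1, m] H) := by
      rw [← aeval_eq_eval]
      exact (aeval_algebraMap_apply (B := MvPolynomial (Fin 2) F) ![1, m] H)
    rw [h2, hm, map_zero, mul_zero] at h
    rw [← h]
    congr 2
    ext i; fin_cases i <;> simp [mul_comm]
  have key : ∀ p : MvPolynomial (Fin 2) F, (X 1 - C m * X 0) ∣
      p - aeval (![X 0, C m * X 0] : Fin 2 → MvPolynomial (Fin 2) F) p := fun p => by
    rw [← Ideal.mem_span_singleton, ← Ideal.Quotient.eq]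
    let π := Ideal.Quotient.mkₐ F (Ideal.span {(X 1 - C m * X 0 : MvPolynomial (Fin 2) F)})
    have : π.comp (aeval (![X 0, C m * X 0] : Fin 2 → MvPolynomial (Fin 2) F)) = π := by
      ext i
      fin_cases i
      · simp
      · simp only [AlgHom.comp_apply, aeval_X]
        exact ((Ideal.Quotient.eq).2 (Ideal.mem_span_singleton_self _)).symm
    exact (AlgHom.congr_fun this p).symm
  have := key H
  rwa [h0, sub_zero] at this

theorem exists_prod_linear_mul {M : Finset F} : ∀ {H : MvPolynomial (Fin 2) F} {n : ℕ},
    H.IsHomogeneous n → (∀ m ∈ M, eval ![1, m] H = 0) →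
    H = 0 ∨ ∃ r k, k + M.card = n ∧ r.IsHomogeneous k ∧
      H = (∏ m ∈ M, (X 1 - C m * X 0)) * r := by
  classical
  induction M using Finset.induction_on with
  | empty => exact fun hH _ => Or.inr ⟨_, _, rfl, hH, by simp⟩
  | insert m M hm ih =>
    intro H n hH h
    have hL : (X 1 - C m * X 0 : MvPolynomial (Fin 2) F).IsHomogeneous 1 :=
      (isHomogeneous_X _ _).sub (isHomogeneous_C_mul_X _ _)
    obtain h0 | ⟨r, k, rfl, hr, rfl⟩ := exists_isHomogeneous_mul_of_dvd hH hL
      (linear_dvd_of_isHomogeneous_of_eval_eq_zero hH (h m (Finset.mem_insert_self _ _)))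
    · exact Or.inl h0
    obtain h0 | ⟨s, l, rfl, hs, rfl⟩ := ih hr (fun m' hm' => by
      have := h m' (Finset.mem_insert_of_mem hm')
      rw [map_mul] at this
      refine (mul_eq_zero.1 this).resolve_left ?_
      simp only [map_sub, map_mul, eval_X, eval_C, Matrix.cons_val_one, Matrix.cons_val_zero,
        mul_one]
      exact sub_ne_zero.2 fun h => hm (h ▸ hm'))
    · left; rw [h0, mul_zero]
    · right
      refine ⟨s, l, ?_, hs, ?_⟩
      · rw [Finset.card_insert_of_notMem hm]; omega
      · rw [Finset.prod_insert hm]; ring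

end

/-- The square of the product of the tangent lines at `(a, v a)`, as a binary form in the direction
of a line through that point. -/
noncomputable def tangentForm {F : Type*} [Field F] [Fintype F] [DecidableEq F] (D : Finset F)
    (v : F → F) (a : F) : MvPolynomial (Fin 2) F :=
  C (∏ c ∈ Dᶜ, (a - c)) ^ 2 * ∏ m ∈ tangentSlopes D v a, (X 1 - C m * X 0) ^ 2

section
variable {F : Type*} [Field F] [Fintype F] [DecidableEq F] {D : Finset F} {v : F → F}

theorem aeval_tangentForm {B : Type*} [CommRing B] [Algebra F B] (a : F) (x : Fin 2 → B) :
    aeval x (tangentForm D v a) = aeval (fun i => algebraMap F B (graphPt v a i) + x i)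
      (tangentPoly D v a) ^ 2 := by
  rw [aeval_tangentPoly, mul_pow, ← Finset.prod_pow]
  simp [tangentForm, algHom_C]

theorem isHomogeneous_tangentForm (hv : IsGraphArc D v) {t : ℕ}
    (hD : D.card + t = Fintype.card F + 1) {a : F} (ha : a ∈ D) :
    (tangentForm D v a).IsHomogeneous (2 * t) := by
  have h1 : (∏ m ∈ tangentSlopes D v a, (X 1 - C m * X 0 : MvPolynomial (Fin 2) F) ^ 2
      ).IsHomogeneous
      (∑ m ∈ tangentSlopes D v a, 1 * 2) :=
    IsHomogeneous.prod _ _ _ fun m _ =>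
      ((isHomogeneous_X _ _).sub (isHomogeneous_C_mul_X _ _)).pow 2
  rw [Finset.sum_const, card_tangentSlopes hv hD ha, smul_eq_mul, one_mul, mul_comm] at h1
  rw [tangentForm, ← map_pow]
  exact h1.C_mul _

theorem eval_tangentForm_chordSlope (hq : Odd (Fintype.card F)) (hv : IsGraphArc D v) {t : ℕ}
    (hD : D.card + t = Fintype.card F + 1) (ht : t ≠ 0) {a b : F} (ha : a ∈ D) (hb : b ∈ D)
    (hab : a ≠ b) : eval ![1, chordSlope v a b] (tangentForm D v a) =
      eval ![1, chordSlope v a b] (tangentForm D v b) := by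
  have hba : b - a ≠ 0 := sub_ne_zero.2 hab.symm
  have key : ∀ c ∈ D, ∀ d : F, ∀ z : F, z = v c + chordSlope v a b * (d - c) →
      (d - c) ^ (2 * t) * eval ![1, chordSlope v a b] (tangentForm D v c) =
        eval ![d, z] (tangentPoly D v c) ^ 2 := by
    rintro c hc d z rfl
    rw [← aeval_eq_eval, aeval_tangentForm, mul_comm 2 t, pow_mul, ← mul_pow,
      ← aeval_tangentPoly_homothety hv hD hc]
    congr 1
    rw [aeval_eq_eval]
    congr 2
    ext i; fin_cases i
    · simp
    · simp; ring
  have h1 := key a ha b (v b) (by rw [chordSlope]; field_simp; ring)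
  have h2 := key b hb a (v a) (by rw [chordSlope]; field_simp; ring)
  have h3 := eval_tangentPoly_comm hq hv hD ht ha hb
  have h4 : eval ![b, v b] (tangentPoly D v a) ^ 2 = eval ![a, v a] (tangentPoly D v b) ^ 2 := by
    change eval (graphPt v b) _ ^ 2 = eval (graphPt v a) _ ^ 2
    rw [h3, mul_pow, ← pow_mul, mul_comm (t + 1) 2, pow_mul]; simp
  rw [← h2, ← h1, ← neg_sub b a, (even_two_mul t).neg_pow] at h4
  exact mul_left_cancel₀ (pow_ne_zero _ hba) h4

/-- Segre's envelope of tangents, in line coordinates. -/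
theorem exists_isHomogeneous_envelope (hq : Odd (Fintype.card F)) (hv : IsGraphArc D v) {t : ℕ}
    (hD : D.card + t = Fintype.card F + 1) (ht : t ≠ 0) :
    ∃ Γ : MvPolynomial (Fin 3) F, Γ.IsHomogeneous (2 * t) ∧ ∀ a ∈ D,
      aeval ![X 0, X 1, C (v a) * X 0 - C a * X 1] Γ = tangentForm D v a := by
  suffices h : ∀ T ⊆ D, ∃ Γ : MvPolynomial (Fin 3) F, Γ.IsHomogeneous (2 * t) ∧ ∀ a ∈ T,
      aeval ![X 0, X 1, C (v a) * X 0 - C a * X 1] Γ = tangentForm D v a from h D subset_rfl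
  intro T
  induction T using Finset.induction_on with
  | empty => exact fun _ => ⟨0, isHomogeneous_zero _ _ _, by simp⟩
  | insert a T haT ih =>
    intro hT
    obtain ⟨ha, hT⟩ := Finset.insert_subset_iff.1 hT
    obtain ⟨Γ, hΓ, hΓT⟩ := ih hT
    let pt : F → Fin 3 → MvPolynomial (Fin 2) F := fun c => ![X 0, X 1, C (v c) * X 0 - C c * X 1]
    have hpt : ∀ c j, (pt c j).IsHomogeneous 1 := fun c j => by
      fin_cases j
      · exact isHomogeneous_X _ _
      · exact isHomogeneous_X _ _
      · exact (isHomogeneous_C_mul_X _ _).sub (isHomogeneous_C_mul_X _ _)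
    have hH : (tangentForm D v a - aeval (pt a) Γ).IsHomogeneous (2 * t) := by
      refine (isHomogeneous_tangentForm hv hD ha).sub ?_
      simpa using hΓ.aeval (pt a) (hpt a)
    have hne : ∀ i ∈ T, i - a ≠ 0 := fun i hi => sub_ne_zero.2 fun h => haT (h ▸ hi)
    have hvan : ∀ m ∈ T.image (chordSlope v a),
        eval ![1, m] (tangentForm D v a - aeval (pt a) Γ) = 0 := by
      intro m hm
      obtain ⟨i, hi, rfl⟩ := Finset.mem_image.1 hm
      rw [map_sub, eval_tangentForm_chordSlope hq hv hD ht ha (hT hi)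
        (fun h => haT (h ▸ hi)), ← hΓT i hi, sub_eq_zero, ← aeval_eq_eval]
      have hc : ∀ c, aeval ![1, chordSlope v a i] (aeval (pt c) Γ) =
          aeval ![1, chordSlope v a i, v c - c * chordSlope v a i] Γ := fun c => by
        rw [← AlgHom.comp_apply, comp_aeval]
        congr 2
        ext j; fin_cases j <;> simp [pt]
      rw [hc, hc]
      congr 4
      have := hne i hi
      rw [chordSlope]; field_simp; ring_nf
    obtain h0 | ⟨r, k, hk, hr, h⟩ := exists_prod_linear_mul hH hvan
    · refine ⟨Γ, hΓ, fun c hc => ?_⟩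
      obtain rfl | hc := Finset.mem_insert.1 hc
      · exact (sub_eq_zero.1 h0).symm
      · exact hΓT c hc
    have hinj : Set.InjOn (chordSlope v a) (T : Set F) := fun x hx y hy h =>
      chordSlope_injOn hv ha
        (Finset.mem_coe.2 (Finset.mem_erase.2 ⟨fun h => haT (h ▸ hx), hT hx⟩))
        (Finset.mem_coe.2 (Finset.mem_erase.2 ⟨fun h => haT (h ▸ hy), hT hy⟩)) h
    rw [Finset.card_image_of_injOn hinj] at hk
    rw [Finset.prod_image hinj] at h
    let ℓ : F → MvPolynomial (Fin 3) F := fun i => X 2 - C (v i) * X 0 + C i * X 1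
    let r' : MvPolynomial (Fin 3) F := aeval ![X 0, X 1] r
    have hℓ : ∀ i, (ℓ i).IsHomogeneous 1 := fun i =>
      ((isHomogeneous_X _ _).sub (isHomogeneous_C_mul_X _ _)).add (isHomogeneous_C_mul_X _ _)
    have hr' : r'.IsHomogeneous k := by
      have := hr.aeval (R := F) (n := 1) (![X 0, X 1] : Fin 2 → MvPolynomial (Fin 3) F)
        (fun j => by fin_cases j <;> exact isHomogeneous_X _ _)
      rwa [one_mul] at this
    have haℓ : ∀ c i, aeval (pt c) (ℓ i) = C (v c - v i) * X 0 - C (c - i) * X 1 := fun c i => by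
      simp [ℓ, pt, algHom_C]; ring
    have har : ∀ c, aeval (pt c) r' = r := fun c => by
      simp only [r']
      rw [← AlgHom.comp_apply, comp_aeval]
      conv_rhs => rw [← aeval_X_left_apply r]
      congr 2
      ext j; fin_cases j <;> simp [pt]
    refine ⟨Γ + C (∏ i ∈ T, (i - a))⁻¹ * ((∏ i ∈ T, ℓ i) * r'), hΓ.add ?_, fun c hc => ?_⟩
    · refine IsHomogeneous.C_mul ?_ _
      have := (IsHomogeneous.prod T ℓ (fun _ => 1) fun i _ => hℓ i).mul hr'
      simp only [Finset.sum_const, smul_eq_mul, mul_one] at this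
      rwa [add_comm, hk] at this
    · change aeval (pt c) _ = _
      simp only [map_add, map_mul, map_prod, haℓ, har, algHom_C]
      obtain rfl | hc := Finset.mem_insert.1 hc
      · symm
        rw [← sub_eq_iff_eq_add', h, ← mul_assoc]
        congr 1
        have : ∀ i ∈ T, (C (v c - v i) * X 0 - C (c - i) * X 1 : MvPolynomial (Fin 2) F) =
            C (i - c) * (X 1 - C (chordSlope v c i) * X 0) := fun i hi => by
          rw [mul_sub, ← mul_assoc, ← C_mul, chordSlope, mul_div_cancel₀ _ (hne i hi)]
          simp; ring
        rw [Finset.prod_congr rfl this, Finset.prod_mul_distrib, ← map_prod, ← mul_assoc,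
          algebraMap_eq, ← C_mul, inv_mul_cancel₀ (Finset.prod_ne_zero_iff.2 hne), C_1, one_mul]
      · have h0 : ∏ i ∈ T, (C (v c - v i) * X 0 - C (c - i) * X 1 : MvPolynomial (Fin 2) F) = 0 :=
          Finset.prod_eq_zero hc (by simp)
        rw [h0, zero_mul, mul_zero, add_zero]
        exact hΓT c hc
end

theorem aeval_mem_biPoly {F : Type*} [Field F] {Γ : MvPolynomial (Fin 3) F} {n : ℕ}
    (hΓ : Γ.IsHomogeneous n) {g : Fin 3 → MvPolynomial (Fin 2) F ⊗[F] MvPolynomial (Fin 2) F}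
    (hg : ∀ i, g i ∈ biPoly F 1) : aeval g Γ ∈ biPoly F n := by
  rw [aeval_def, eval₂_eq']
  refine Submodule.sum_mem _ fun d hd => ?_
  rw [← Algebra.smul_def]
  refine Submodule.smul_mem _ _ ?_
  have hdeg : d 0 + d 1 + d 2 = n := by
    have : d.degree = n := by
      by_contra hne; exact (mem_support_iff.1 hd) (hΓ.coeff_eq_zero hne)
    rw [← this, Finsupp.degree_eq_sum, Fin.sum_univ_three]
  rw [Fin.prod_univ_three, ← hdeg]
  have h := fun i => pow_mem_biPoly (m := d i) (hg i)
  simp only [mul_one] at h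
  exact mul_mem_biPoly (mul_mem_biPoly (h 0) (h 1)) (h 2)

/-- `Φ` interpolates the tangent polynomials of the arc, and `G` is a bi-polynomial agreeing with
`Φ ^ 2` on the arc whose restriction to pairs of points on a line through a point of the arc is a
square. -/
structure IsSegrePair.{u} {F : Type u} [Field F] [Fintype F] [DecidableEq F] (D : Finset F)
    (v : F → F) (t : ℕ) (Φ G : MvPolynomial (Fin 2) F ⊗[F] MvPolynomial (Fin 2) F) : Prop where
  mem_left : Φ ∈ biPoly F t
  mem_right : G ∈ biPoly F (2 * t)
  eval_left : ∀ a ∈ D, ∀ b ∈ D, biEval F (graphPt v a) (graphPt v b) Φ =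
    eval (graphPt v a) (tangentPoly D v b)
  eval_sub : ∀ a ∈ D, ∀ b ∈ D, biEval F (graphPt v a) (graphPt v b) (Φ ^ 2 - G) = 0
  eval_right : ∀ {B : Type u} [CommRing B] [Algebra F B], ∀ a ∈ D, ∀ (l : B) (Y : Fin 2 → B),
    biEval F (fun i => algebraMap F B (graphPt v a i) +
      l * (Y i - algebraMap F B (graphPt v a i))) Y G =
      (l - 1) ^ (2 * t) * aeval Y (tangentPoly D v a) ^ 2

theorem exists_isSegrePair.{u} {F : Type u} [Field F] [Fintype F] [DecidableEq F] {D : Finset F}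
    {v : F → F} (hq : Odd (Fintype.card F)) (hv : IsGraphArc D v) {t : ℕ}
    (hD : D.card + t = Fintype.card F + 1) (ht : t ≠ 0) : ∃ Φ G, IsSegrePair D v t Φ G := by
  obtain ⟨Φ, hΦ, hΦ'⟩ := exists_biPoly_tangentPoly hq hv hD ht
  obtain ⟨Γ, hΓ, hΓ'⟩ := exists_isHomogeneous_envelope hq hv hD ht
  let P := MvPolynomial (Fin 2) F
  have hX (i : Fin 2) : (X i : P).totalDegree ≤ 1 := (totalDegree_X _).le
  have h1 : (1 : P).totalDegree ≤ 1 := by simp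
  let g : Fin 3 → P ⊗[F] P := ![X 0 ⊗ₜ 1 - 1 ⊗ₜ X 0, X 1 ⊗ₜ 1 - 1 ⊗ₜ X 1,
    X 0 ⊗ₜ X 1 - X 1 ⊗ₜ X 0]
  have hg : ∀ i, g i ∈ biPoly F 1 := fun i => by
    fin_cases i
    · exact Submodule.sub_mem _ (tmul_mem_biPoly (hX 0) h1) (tmul_mem_biPoly h1 (hX 0))
    · exact Submodule.sub_mem _ (tmul_mem_biPoly (hX 1) h1) (tmul_mem_biPoly h1 (hX 1))
    · exact Submodule.sub_mem _ (tmul_mem_biPoly (hX 0) (hX 1)) (tmul_mem_biPoly (hX 1) (hX 0))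
  have hG {B : Type u} [CommRing B] [Algebra F B] (x y : Fin 2 → B) :
      biEval F x y (aeval g Γ) =
        aeval ![x 0 - y 0, x 1 - y 1, x 0 * y 1 - x 1 * y 0] Γ := by
    rw [← AlgHom.comp_apply, comp_aeval]
    congr 2
    ext i; fin_cases i <;> simp [g, biEval_tmul]
  have hT {B : Type u} [CommRing B] [Algebra F B] {a : F} (ha : a ∈ D) (x : Fin 2 → B) :
      aeval ![x 0, x 1, algebraMap F B (v a) * x 0 - algebraMap F B a * x 1] Γ =
        aeval (fun i => algebraMap F B (graphPt v a i) + x i) (tangentPoly D v a) ^ 2 := by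
    rw [← aeval_tangentForm, ← hΓ' a ha, ← AlgHom.comp_apply, comp_aeval]
    congr 2
    ext i; fin_cases i <;> simp [algHom_C]
  refine ⟨Φ, aeval g Γ, hΦ, aeval_mem_biPoly hΓ hg, hΦ', fun a ha b hb => ?_, ?_⟩
  · have h2 := hT hb (fun i => graphPt v a i - graphPt v b i)
    rw [map_sub, map_pow, hΦ' a ha b hb, hG, sub_eq_zero]
    simp only [Algebra.algebraMap_self, RingHom.id_apply, add_sub_cancel] at h2
    rw [← aeval_eq_eval]
    change aeval (graphPt v a) _ ^ 2 = _
    refine h2.symm.trans ?_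
    congr 2
    ext i; fin_cases i
    · rfl
    · rfl
    · simp; ring
  · intro B _ _ a ha l Y
    rw [hG, mul_comm 2 t, pow_mul, ← mul_pow, ← aeval_tangentPoly_homothety hv hD ha, ← hT ha]
    congr 2
    ext i; fin_cases i <;> simp <;> ring

/-- Every polynomial of degree at most `n` vanishing on the graph of `v` over `S` vanishes at the
generalized point `Y`. -/
def LiesOn {F B : Type*} [Field F] [CommRing B] [Algebra F B] (S : Finset F) (v : F → F) (n : ℕ)
    (Y : Fin 2 → B) : Prop :=
  ∀ ψ : MvPolynomial (Fin 2) F, ψ.totalDegree ≤ n → (∀ a ∈ S, eval (graphPt v a) ψ = 0) →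
    aeval Y ψ = 0

theorem totalDegree_biEval_le {F : Type*} [Field F] {t : ℕ}
    {Φ : MvPolynomial (Fin 2) F ⊗[F] MvPolynomial (Fin 2) F} (hΦ : Φ ∈ biPoly F t)
    {X Y : Fin 2 → MvPolynomial (Fin 2) F}
    (h : (∀ p : MvPolynomial (Fin 2) F, p.totalDegree ≤ t →
      (aeval X p).totalDegree + 0 ≤ 0 ∧ (aeval Y p).totalDegree ≤ t) ∨
      (∀ p : MvPolynomial (Fin 2) F, p.totalDegree ≤ t →
      (aeval Y p).totalDegree + 0 ≤ 0 ∧ (aeval X p).totalDegree ≤ t)) :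
    (biEval F X Y Φ).totalDegree ≤ t := by
  obtain ⟨N, p, q, hp, hq, rfl⟩ := mem_biPoly_iff.1 hΦ
  rw [map_sum]
  refine totalDegree_finsetSum_le fun i _ => ?_
  rw [biEval_tmul]
  refine (totalDegree_mul _ _).trans ?_
  obtain h | h := h
  · have := (h _ (hp i)).1; have := (h _ (hq i)).2; omega
  · have := (h _ (hp i)).2; have := (h _ (hq i)).1; omega

section
universe u
variable {F : Type u} [Field F]

theorem aeval_comp_C (x : Fin 2 → F) (p : MvPolynomial (Fin 2) F) {B : Type*} [CommRing B]
    [Algebra F B] : aeval (fun i => algebraMap F B (x i)) p = algebraMap F B (eval x p) := by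
  rw [← aeval_eq_eval]; exact aeval_algebraMap_apply (B := B) x p

theorem totalDegree_biEval_const_left_le {t : ℕ}
    {Φ : MvPolynomial (Fin 2) F ⊗[F] MvPolynomial (Fin 2) F} (hΦ : Φ ∈ biPoly F t)
    (x : Fin 2 → F) :
    (biEval F (fun i => algebraMap F (MvPolynomial (Fin 2) F) (x i)) X Φ).totalDegree ≤ t :=
  totalDegree_biEval_le hΦ (Or.inl fun p hp => ⟨by
    rw [aeval_comp_C, algebraMap_eq, totalDegree_C], by rwa [aeval_X_left_apply]⟩)

theorem totalDegree_biEval_const_right_le {t : ℕ}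
    {Φ : MvPolynomial (Fin 2) F ⊗[F] MvPolynomial (Fin 2) F} (hΦ : Φ ∈ biPoly F t)
    (x : Fin 2 → F) :
    (biEval F X (fun i => algebraMap F (MvPolynomial (Fin 2) F) (x i)) Φ).totalDegree ≤ t :=
  totalDegree_biEval_le hΦ (Or.inr fun p hp => ⟨by
    rw [aeval_comp_C, algebraMap_eq, totalDegree_C], by rwa [aeval_X_left_apply]⟩)

variable [Fintype F] [DecidableEq F] {D S : Finset F} {v : F → F} {t : ℕ}
  {Φ G : MvPolynomial (Fin 2) F ⊗[F] MvPolynomial (Fin 2) F}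

theorem totalDegree_tangentPoly_le' (hv : IsGraphArc D v) (hD : D.card + t = Fintype.card F + 1)
    {a : F} (ha : a ∈ D) : (tangentPoly D v a).totalDegree ≤ t :=
  (totalDegree_tangentPoly_le a).trans (card_tangentSlopes hv hD ha).le

theorem IsSegrePair.biEval_left (h : IsSegrePair D v t Φ G)
    (hv : IsGraphArc D v) (hD : D.card + t = Fintype.card F + 1)
    (hS : S ⊆ D) {B : Type*} [CommRing B] [Algebra F B] {Y : Fin 2 → B} (hY : LiesOn S v (2 * t) Y)
    {b : F} (hb : b ∈ D) : biEval F Y (fun i => algebraMap F B (graphPt v b i)) Φ =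
      aeval Y (tangentPoly D v b) := by
  have h1 := hY (biEval F X (fun i => algebraMap F _ (graphPt v b i)) Φ - tangentPoly D v b) ?_ ?_
  · rw [map_sub, sub_eq_zero, biEval_comp] at h1
    rw [← h1]
    congr 2 <;> ext i <;> simp
  · refine (totalDegree_sub _ _).trans (max_le ?_ ?_)
    · have := totalDegree_biEval_const_right_le h.mem_left (graphPt v b); omega
    · have := totalDegree_tangentPoly_le' hv hD hb; omega
  · intro a ha
    rw [map_sub, sub_eq_zero, ← h.eval_left a (hS ha) b hb]
    simp only [← aeval_eq_eval]
    rw [biEval_comp]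
    congr 2 <;> ext i <;> simp

theorem IsSegrePair.biEval_right (h : IsSegrePair D v t Φ G) (hq : Odd (Fintype.card F))
    (hv : IsGraphArc D v) (hD : D.card + t = Fintype.card F + 1) (ht : t ≠ 0)
    (hS : S ⊆ D) {B : Type*} [CommRing B] [Algebra F B] {Y : Fin 2 → B} (hY : LiesOn S v (2 * t) Y)
    {b : F} (hb : b ∈ D) : biEval F (fun i => algebraMap F B (graphPt v b i)) Y Φ =
      (-1) ^ (t + 1) * aeval Y (tangentPoly D v b) := by
  have h1 := hY (biEval F (fun i => algebraMap F _ (graphPt v b i)) X Φ -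
    C ((-1) ^ (t + 1)) * tangentPoly D v b) ?_ ?_
  · rw [map_sub, sub_eq_zero, biEval_comp, map_mul, algHom_C] at h1
    rw [map_pow, map_neg, map_one] at h1
    rw [← h1]
    congr 2 <;> ext i <;> simp
  · refine (totalDegree_sub _ _).trans (max_le ?_ ?_)
    · have := totalDegree_biEval_const_left_le h.mem_left (graphPt v b); omega
    · refine (totalDegree_mul _ _).trans ?_
      rw [totalDegree_C]
      have := totalDegree_tangentPoly_le' hv hD hb; omega
  · intro a ha
    rw [map_sub, sub_eq_zero, map_mul, eval_C, ← eval_tangentPoly_comm hq hv hD ht (hS ha) hb,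
      ← h.eval_left b hb a (hS ha)]
    rw [← aeval_eq_eval]
    rw [biEval_comp]
    congr 2 <;> ext i <;> simp

theorem IsSegrePair.biEval_sq (h : IsSegrePair D v t Φ G) (hS : S ⊆ D) {B : Type u} [CommRing B]
    [Algebra F B] {a : F} (ha : a ∈ D) {l : B} {Y : Fin 2 → B} (hY : LiesOn S v (2 * t) Y)
    (hX : LiesOn S v (2 * t) (fun i => algebraMap F B (graphPt v a i) +
      l * (Y i - algebraMap F B (graphPt v a i)))) :
    biEval F (fun i => algebraMap F B (graphPt v a i) +
      l * (Y i - algebraMap F B (graphPt v a i))) Y Φ ^ 2 =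
      ((l - 1) ^ t * aeval Y (tangentPoly D v a)) ^ 2 := by
  have h1 := biEval_eq_zero_of_forall (E := Φ ^ 2 - G) (n := 2 * t) (graphPt v '' S)
    (Submodule.sub_mem _ (pow_mem_biPoly h.mem_left) h.mem_right)
    (by rintro _ ⟨a, ha, rfl⟩ _ ⟨b, hb, rfl⟩; exact h.eval_sub a (hS ha) b (hS hb)) _ Y
    (fun ψ h1 h2 => hX ψ h1 fun a ha => h2 _ ⟨a, ha, rfl⟩)
    (fun ψ h1 h2 => hY ψ h1 fun a ha => h2 _ ⟨a, ha, rfl⟩)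
  rw [map_sub, sub_eq_zero, h.eval_right a ha, map_pow] at h1
  rw [h1]; ring

theorem two_ne_zero_of_odd_card {F : Type*} [Field F] [Fintype F] (hq : Odd (Fintype.card F)) :
    (2 : F) ≠ 0 := by
  intro h
  have : ringChar F = 2 := by
    have h2 : ringChar F ∣ 2 := (ringChar.spec F 2).1 (by exact_mod_cast h)
    exact ((Nat.dvd_prime Nat.prime_two).1 h2).resolve_left (CharP.ringChar_ne_one)
  have := FiniteField.even_card_iff_char_two.1 this
  exact (Nat.not_even_iff_odd.2 hq) (Nat.even_iff.2 this)

/-- A large arc lies on a curve of degree at most twice the number of tangents. -/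
theorem exists_ne_zero_vanishing (hq : Odd (Fintype.card F)) (hv : IsGraphArc D v)
    (hD : D.card + t = Fintype.card F + 1) (ht : t ≠ 0) (hD2 : 1 < D.card) :
    ∃ ψ : MvPolynomial (Fin 2) F, ψ.totalDegree ≤ 2 * t ∧
      (∀ a ∈ D, eval (graphPt v a) ψ = 0) ∧ ψ ≠ 0 := by
  by_contra! hno
  obtain ⟨Φ, G, h⟩ := exists_isSegrePair hq hv hD ht
  obtain ⟨a, ha, b, hb, hab⟩ := Finset.one_lt_card.1 hD2
  have hlie {B : Type u} [CommRing B] [Algebra F B] (Y : Fin 2 → B) : LiesOn D v (2 * t) Y :=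
    fun ψ h1 h2 => by rw [hno ψ h1 h2, map_zero]
  have h2 := two_ne_zero_of_odd_card hq
  let B := MvPolynomial (Fin 2) F
  let Y : Fin 2 → B := fun i => algebraMap F B (graphPt v a i) +
    X 1 * (algebraMap F B (graphPt v b i) - algebraMap F B (graphPt v a i))
  have key := h.biEval_sq subset_rfl (B := B) ha (l := X 0) (hlie Y) (hlie _)
  have hY : aeval Y (tangentPoly D v a) =
      X 1 ^ t * algebraMap F B (eval (graphPt v b) (tangentPoly D v a)) := by
    rw [aeval_tangentPoly_homothety hv hD ha, aeval_comp_C]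
  set κ := eval (graphPt v b) (tangentPoly D v a) with hκ
  have hκ0 : κ ≠ 0 := eval_tangentPoly_ne_zero hv ha hb hab
  have hκ' : eval (graphPt v a) (tangentPoly D v b) = (-1) ^ (t + 1) * κ :=
    eval_tangentPoly_comm hq hv hD ht hb ha
  have ev (l m : F) : aeval ![l, m] (biEval F (fun i => algebraMap F B (graphPt v a i) +
      X 0 * (Y i - algebraMap F B (graphPt v a i))) Y Φ) =
      biEval F (fun i => graphPt v a i + l * (m * (graphPt v b i - graphPt v a i)))
        (fun i => graphPt v a i + m * (graphPt v b i - graphPt v a i)) Φ := by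
    rw [biEval_comp]
    congr 2 <;> ext i <;> simp [Y, B]
  have e1 := ev 0 1
  simp only [zero_mul, add_zero, one_mul, add_sub_cancel] at e1
  rw [show biEval F (fun i => graphPt v a i) (fun i => graphPt v b i) Φ = _ from
    h.eval_left a ha b hb, hκ'] at e1
  have e2 := ev (-1) (-1)
  rw [show (fun i => graphPt v a i + -1 * (-1 * (graphPt v b i - graphPt v a i))) =
    fun i => algebraMap F F (graphPt v b i) by ext i; simp,
    h.biEval_right hq hv hD ht subset_rfl (hlie _) hb,
    show (fun i => graphPt v a i + -1 * (graphPt v b i - graphPt v a i)) =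
      fun i => algebraMap F F (graphPt v b i) +
        2 * (graphPt v a i - algebraMap F F (graphPt v b i)) by ext i; simp; ring,
    aeval_tangentPoly_homothety hv hD hb,
    show aeval (graphPt v a) (tangentPoly D v b) = _ from
      congrFun (aeval_eq_eval (graphPt v a)) _] at e2
  have e2' : (-1 : F) ^ (t + 1) * (2 ^ t * eval (graphPt v a) (tangentPoly D v b)) = 2 ^ t * κ := by
    rw [hκ']
    have : ((-1 : F) ^ (t + 1)) * (-1) ^ (t + 1) = 1 := by rw [← mul_pow]; simp
    linear_combination 2 ^ t * κ * this
  rw [e2'] at e2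
  rw [hY] at key
  obtain hk | hk := sq_eq_sq_iff_eq_or_eq_neg.1 key
  · rw [hk] at e1
    simp only [B, algHom_C, algebraMap_eq, map_mul, map_pow, map_sub, aeval_X, map_one,
      Matrix.cons_val_one, Matrix.cons_val_zero, zero_sub, one_pow, one_mul,
      Algebra.algebraMap_self, RingHom.id_apply, pow_succ] at e1
    have : (2 : F) * ((-1) ^ t * κ) = 0 := by linear_combination e1
    simp [h2, hκ0] at this
  · rw [hk] at e2
    simp only [map_neg, map_mul, map_pow, map_sub, aeval_X, map_one, B, algebraMap_eq,
      algHom_C, Matrix.cons_val_one, Matrix.cons_val_zero] at e2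
    rw [← mul_assoc, ← mul_pow] at e2
    have : (2 : F) * (2 ^ t * κ) = 0 := by
      rw [show (-1 - 1 : F) * -1 = 2 by ring] at e2
      simp only [Algebra.algebraMap_self, RingHom.id_apply] at e2
      linear_combination -e2
    simp [h2, hκ0] at this
end

section
open Polynomial

theorem Polynomial.exists_C_leadingCoeff_pow_mul_eq {A : Type*} [CommRing A] (f : A[X])
    (hf : 0 < f.natDegree) (g : A[X]) :
    ∃ (N : ℕ) (p r : A[X]), C (f.leadingCoeff ^ N) * g = f * p + r ∧ r.natDegree < f.natDegree := by
  obtain ⟨n, hn⟩ : ∃ n, g.natDegree < n := ⟨_, Nat.lt_succ_self _⟩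
  induction n generalizing g with
  | zero => omega
  | succ n ih =>
    by_cases h : g.natDegree < f.natDegree
    · exact ⟨0, 0, g, by simp, h⟩
    push Not at h
    have hlt : (C f.leadingCoeff * g -
        C g.leadingCoeff * X ^ (g.natDegree - f.natDegree) * f).natDegree < n := by
        refine lt_of_lt_of_le (lt_of_le_of_ne (b := g.natDegree) ?_ fun he => ?_)
          (Nat.lt_succ_iff.1 hn)
        · refine (natDegree_sub_le _ _).trans (max_le
            (Polynomial.natDegree_C_mul_le f.leadingCoeff g) ?_)
          refine natDegree_mul_le.trans ?_
          have := Polynomial.natDegree_C_mul_X_pow_le g.leadingCoeff (g.natDegree - f.natDegree)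
          omega
        · have h0 : (C f.leadingCoeff * g -
              C g.leadingCoeff * X ^ (g.natDegree - f.natDegree) * f).coeff g.natDegree = 0 := by
            rw [coeff_sub, coeff_C_mul, mul_assoc, coeff_C_mul, coeff_X_pow_mul',
              if_pos (Nat.sub_le _ _), Nat.sub_sub_self h, coeff_natDegree, coeff_natDegree]
            ring
          rw [leadingCoeff_eq_zero.1 ((congrArg _ he).trans h0), natDegree_zero] at he
          omega
    obtain ⟨N, p, r, h1, h2⟩ := ih _ hlt
    refine ⟨N + 1, p + C (f.leadingCoeff ^ N) * C g.leadingCoeff *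
      X ^ (g.natDegree - f.natDegree), r, ?_, h2⟩
    rw [pow_succ, C_mul]
    linear_combination h1

/-- Coprimality to `r` of a divisor of `r * r'` specializes backwards. -/
theorem Polynomial.dvd_C_leadingCoeff_pow_mul_of_isCoprime_map {A K : Type*} [CommRing A]
    [IsDomain A] [Field K] (π : A →+* K) {f r r' : A[X]} (h : f ∣ r * r')
    (hf : π f.leadingCoeff ≠ 0) (hc : IsCoprime (f.map π) (r.map π)) :
    ∃ N, f ∣ C (f.leadingCoeff ^ N) * r' := by
  rcases Nat.eq_zero_or_pos f.natDegree with h0 | h0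
  · refine ⟨1, ?_⟩
    rw [pow_one]
    nth_rw 1 [eq_C_of_natDegree_eq_zero h0]
    rw [leadingCoeff, h0]
    exact dvd_mul_right _ _
  have hdeg : (f.map π).natDegree = f.natDegree := natDegree_map_of_leadingCoeff_ne_zero π hf
  have hres : π (f.resultant r) ≠ 0 := by
    rw [← resultant_map_map]
    obtain ⟨k, hk⟩ := Nat.exists_eq_add_of_le (natDegree_map_le (f := π) (p := r))
    rw [hk, resultant_add_right_deg _ _ _ _ _ le_rfl, ← hdeg]
    refine mul_ne_zero (pow_ne_zero _ ?_) (resultant_ne_zero _ _ hc)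
    rw [hdeg, coeff_map]; exact hf
  have hres0 : f.resultant r ≠ 0 := fun h => hres (by rw [h, map_zero])
  obtain ⟨p, q, -, -, hpq⟩ := exists_mul_add_mul_eq_C_resultant f r le_rfl le_rfl (Or.inl h0.ne')
  obtain ⟨N, w, s, h1, h2⟩ := exists_C_leadingCoeff_pow_mul_eq f h0 r'
  have hs : f ∣ C (f.resultant r) * s := by
    have : C (f.resultant r) * s = f * (C (f.leadingCoeff ^ N) * p * r' - C (f.resultant r) * w) +
        C (f.leadingCoeff ^ N) * q * (r * r') := by
      rw [← hpq]
      linear_combination -(f * p + r * q) * h1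
    rw [this]
    exact dvd_add (dvd_mul_right _ _) (h.mul_left _)
  have : s = 0 := by
    have := eq_zero_of_dvd_of_natDegree_lt hs (by rwa [natDegree_C_mul hres0])
    simpa [hres0] using this
  exact ⟨N, w, by rw [h1, this, add_zero]⟩
end

/-- The generic point of the line through `a` and `Y`. -/
noncomputable def linePt {F B : Type*} [Field F] [CommRing B] [Algebra F B]
    (a : Fin 2 → F) (Y : Fin 2 → B) (i : Fin 2) : Polynomial B :=
  algebraMap F (Polynomial B) (a i) +
    Polynomial.X * (Polynomial.C (Y i) - algebraMap F (Polynomial B) (a i))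

/-- The restriction of `φ` to the line through `a` and `Y`. -/
noncomputable def linePoly {F B : Type*} [Field F] [CommRing B] [Algebra F B]
    (φ : MvPolynomial (Fin 2) F) (a : Fin 2 → F) (Y : Fin 2 → B) : Polynomial B :=
  aeval (linePt a Y) φ

section
variable {F B B' : Type*} [Field F] [CommRing B] [Algebra F B] [CommRing B'] [Algebra F B']
  (φ : MvPolynomial (Fin 2) F) (a : Fin 2 → F) (Y : Fin 2 → B)

theorem map_linePoly (g : B →ₐ[F] B') :
    (linePoly φ a Y).map (g : B →+* B') = linePoly φ a (fun i => g (Y i)) := by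
  have := (comp_aeval_apply (linePt a Y)
    (Polynomial.mapAlgHom g) φ)
  rw [linePoly, linePoly]
  refine this.trans ?_
  congr 2
  ext i : 1
  simp [linePt]

theorem eval_linePoly (l : B) : (linePoly φ a Y).eval l =
    aeval (fun i => algebraMap F B (a i) + l * (Y i - algebraMap F B (a i))) φ := by
  have := (comp_aeval_apply (linePt a Y)
    ((Polynomial.aeval l).restrictScalars F) φ)
  rw [linePoly]
  refine this.trans ?_
  congr 2
  ext i : 1
  simp [linePt]

theorem natDegree_linePoly_le : (linePoly φ a Y).natDegree ≤ φ.totalDegree := by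
  unfold linePoly
  conv_lhs => rw [φ.as_sum, map_sum]
  refine Polynomial.natDegree_sum_le_of_forall_le _ _ fun s hs => ?_
  have hs' := le_totalDegree hs
  rw [Finsupp.sum_fintype _ _ (by simp), Fin.sum_univ_two] at hs'
  rw [aeval_monomial, Finsupp.prod_fintype _ _ (by simp), Fin.prod_univ_two,
    IsScalarTower.algebraMap_apply F B (Polynomial B), Polynomial.algebraMap_eq]
  have hl (i : Fin 2) : (linePt a Y i).natDegree ≤ 1 := by
    rw [linePt, IsScalarTower.algebraMap_apply F B (Polynomial B), Polynomial.algebraMap_eq]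
    compute_degree!
  have hp (i : Fin 2) := (Polynomial.natDegree_pow_le_of_le (s i) (hl i)).trans (mul_one _).le
  exact (Polynomial.natDegree_C_mul_le _ _).trans
    ((Polynomial.natDegree_mul_le_of_le (hp 0) (hp 1)).trans hs')

theorem coeff_linePoly {d : ℕ} (hd : φ.totalDegree ≤ d) : (linePoly φ a Y).coeff d =
    aeval (fun i => Y i - algebraMap F B (a i)) (homogeneousComponent d φ) := by
  rw [linePoly, homogeneousComponent_apply, map_sum]
  conv_lhs => rw [φ.as_sum, map_sum, Polynomial.finsetSum_coeff]
  rw [Finset.sum_filter]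
  refine Finset.sum_congr rfl fun s hs => ?_
  have hsd : s.degree = s 0 + s 1 := by rw [Finsupp.degree_eq_sum, Fin.sum_univ_two]
  have hs' : s 0 + s 1 ≤ d := by
    have := le_totalDegree hs
    rw [Finsupp.sum_fintype _ _ (by simp), Fin.sum_univ_two] at this
    omega
  simp only [aeval_monomial]
  rw [Finsupp.prod_fintype _ _ (by simp), Fin.prod_univ_two, Finsupp.prod_fintype _ _ (by simp),
    Fin.prod_univ_two, IsScalarTower.algebraMap_apply F B (Polynomial B), Polynomial.algebraMap_eq,
    Polynomial.coeff_C_mul]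
  have hl (i : Fin 2) : (linePt a Y i).natDegree ≤ 1 := by
    rw [linePt, IsScalarTower.algebraMap_apply F B (Polynomial B), Polynomial.algebraMap_eq]
    compute_degree!
  have hl' (i : Fin 2) : (linePt a Y i).coeff 1 = Y i - algebraMap F B (a i) := by
    rw [linePt, IsScalarTower.algebraMap_apply F B (Polynomial B), Polynomial.algebraMap_eq,
      ← map_sub]
    simp
  have hp (i : Fin 2) := (Polynomial.natDegree_pow_le_of_le (s i) (hl i)).trans (mul_one _).le
  split_ifs with h
  · congr 1
    rw [← h, hsd, Polynomial.coeff_mul_add_eq_of_natDegree_le (hp 0) (hp 1), ← hl' 0, ← hl' 1]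
    congr 1
    · simpa using Polynomial.coeff_pow_of_natDegree_le (hl 0) (m := s 0)
    · simpa using Polynomial.coeff_pow_of_natDegree_le (hl 1) (m := s 1)
  · rw [Polynomial.coeff_eq_zero_of_natDegree_lt, mul_zero]
    refine (Polynomial.natDegree_mul_le_of_le (hp 0) (hp 1)).trans_lt ?_
    omega
end

section
universe u

/-- An irreducible curve dividing every curve of degree at most `2 * t` through the graph of `v`
over `S`. -/
structure IsArcCurve {F : Type*} [Field F] (S : Finset F) (v : F → F) (t : ℕ)
    (φ : MvPolynomial (Fin 2) F) : Prop where
  irreducible : Irreducible φ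
  eval_eq_zero : ∀ a ∈ S, eval (graphPt v a) φ = 0
  dvd : ∀ ψ : MvPolynomial (Fin 2) F, ψ.totalDegree ≤ 2 * t →
    (∀ a ∈ S, eval (graphPt v a) ψ = 0) → φ ∣ ψ

theorem exists_genericPoint {F : Type u} [Field F] {φ : MvPolynomial (Fin 2) F}
    (h : Irreducible φ) : ∃ (A : Type u) (_ : CommRing A) (_ : IsDomain A) (_ : Algebra F A)
      (P : Fin 2 → A), aeval P φ = 0 ∧ ∀ (K : Type u) [CommRing K] [Algebra F K] (Y : Fin 2 → K),
        aeval Y φ = 0 → ∃ π : A →ₐ[F] K, ∀ i, π (P i) = Y i := by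
  refine ⟨MvPolynomial (Fin 2) F ⧸ Ideal.span {φ}, inferInstance,
    (Ideal.Quotient.isDomain_iff_prime _).2
      ((Ideal.span_singleton_prime h.ne_zero).2 h.prime), inferInstance,
    fun i => Ideal.Quotient.mkₐ F _ (X i), ?_, fun K _ _ Y hY => ?_⟩
  · rw [← comp_aeval_apply, aeval_X_left_apply]
    exact Ideal.Quotient.eq_zero_iff_mem.2 (Ideal.mem_span_singleton_self φ)
  · refine ⟨Ideal.Quotient.liftₐ _ (aeval Y) fun ψ hψ => ?_, fun i => ?_⟩
    · obtain ⟨χ, rfl⟩ := Ideal.mem_span_singleton.1 hψ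
      rw [map_mul, hY, zero_mul]
    · exact (Ideal.Quotient.lift_mk _ _ _).trans (aeval_X _ _)

variable {F : Type u} [Field F] {D S : Finset F} {v : F → F} {t : ℕ}
  {Φ G : MvPolynomial (Fin 2) F ⊗[F] MvPolynomial (Fin 2) F} {φ : MvPolynomial (Fin 2) F}

theorem IsArcCurve.liesOn (h : IsArcCurve S v t φ) {B : Type*} [CommRing B] [Algebra F B]
    {Y : Fin 2 → B} (hY : aeval Y φ = 0) : LiesOn S v (2 * t) Y := fun ψ h1 h2 => by
  obtain ⟨χ, rfl⟩ := h.dvd ψ h1 h2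
  rw [map_mul, hY, zero_mul]

/-- `Φ` evaluated at the generic point of a line and the direction point. -/
noncomputable def lineBiEval {B : Type*} [CommRing B] [Algebra F B]
    (Φ : MvPolynomial (Fin 2) F ⊗[F] MvPolynomial (Fin 2) F) (a : Fin 2 → F) (Y : Fin 2 → B) :
    Polynomial B :=
  biEval F (linePt a Y) (fun i => Polynomial.C (Y i)) Φ

theorem map_lineBiEval {B B' : Type*} [CommRing B] [Algebra F B] [CommRing B'] [Algebra F B']
    (a : Fin 2 → F) (Y : Fin 2 → B) (g : B →ₐ[F] B') :
    (lineBiEval Φ a Y).map (g : B →+* B') = lineBiEval Φ a (fun i => g (Y i)) := by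
  have := biEval_comp (Polynomial.mapAlgHom g) (linePt a Y) (fun i => Polynomial.C (Y i)) Φ
  refine this.trans ?_
  rw [lineBiEval]
  congr 2 <;> ext i : 1 <;> simp [linePt]

theorem eval_lineBiEval {B : Type*} [CommRing B] [Algebra F B]
    (a : Fin 2 → F) (Y : Fin 2 → B) (l : B) : (lineBiEval Φ a Y).eval l =
      biEval F (fun i => algebraMap F B (a i) + l * (Y i - algebraMap F B (a i))) Y Φ := by
  have := biEval_comp ((Polynomial.aeval l).restrictScalars F) (linePt a Y)
    (fun i => Polynomial.C (Y i)) Φ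
  refine this.trans ?_
  congr 2 <;> ext i : 1 <;> simp [linePt]

variable [Fintype F] [DecidableEq F]

theorem IsSegrePair.linePoly_dvd_sq_sub (h : IsSegrePair D v t Φ G) (hS : S ⊆ D)
    (hφ : IsArcCurve S v t φ) {B : Type u} [CommRing B] [Algebra F B] {P : Fin 2 → B}
    (hP : aeval P φ = 0) {a : F} (ha : a ∈ D) :
    linePoly φ (graphPt v a) P ∣ lineBiEval Φ (graphPt v a) P ^ 2 -
      ((Polynomial.X - 1) ^ t * Polynomial.C (aeval P (tangentPoly D v a))) ^ 2 := by
  set χ := linePoly φ (graphPt v a) P with hχ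
  let g := Ideal.Quotient.mkₐ F (Ideal.span {χ})
  have hg (f : Polynomial B) : g f = 0 ↔ χ ∣ f :=
    Ideal.Quotient.eq_zero_iff_mem.trans Ideal.mem_span_singleton
  have hPC (ψ : MvPolynomial (Fin 2) F) :
      aeval (fun i => g (Polynomial.C (P i))) ψ = g (Polynomial.C (aeval P ψ)) := by
    have := comp_aeval_apply P
      (g.comp ((Polynomial.CAlgHom (R := B) (A := B)).restrictScalars F)) ψ
    exact this.symm
  have hl (i : Fin 2) : g (linePt (graphPt v a) P i) =
      algebraMap F _ (graphPt v a i) + g Polynomial.X *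
        (g (Polynomial.C (P i)) - algebraMap F _ (graphPt v a i)) := by
    rw [linePt, map_add, map_mul, map_sub, AlgHom.commutes]
  have key := h.biEval_sq hS ha (l := g Polynomial.X) (Y := fun i => g (Polynomial.C (P i)))
    (hφ.liesOn (by rw [hPC, hP]; simp)) (hφ.liesOn (by
      simp_rw [← hl]
      rw [← comp_aeval_apply]
      exact (hg _).2 dvd_rfl))
  simp_rw [← hl] at key
  rw [← biEval_comp, hPC] at key
  rw [← hg, map_sub, sub_eq_zero, map_pow, lineBiEval, key]
  simp

theorem linePt_eq_sub {F : Type*} [Field F] (a b : Fin 2 → F) (i : Fin 2) : linePt (B := F) a b i =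
    algebraMap F _ (b i) + (1 - Polynomial.X) *
      (algebraMap F _ (a i) - algebraMap F (Polynomial F) (b i)) := by
  simp only [linePt, Polynomial.algebraMap_eq]
  ring

theorem IsSegrePair.linePoly_dvd_add (h : IsSegrePair D v t Φ G) (hq : Odd (Fintype.card F))
    (hv : IsGraphArc D v) (hD : D.card + t = Fintype.card F + 1) (ht : t ≠ 0) (hS : S ⊆ D)
    (hφ : IsArcCurve S v t φ) {a b : F} (ha : a ∈ D) (hb : b ∈ D) :
    linePoly φ (graphPt v a) (graphPt v b) ∣ lineBiEval Φ (graphPt v a) (graphPt v b) +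
      (Polynomial.X - 1) ^ t * Polynomial.C (eval (graphPt v b) (tangentPoly D v a)) := by
  set χ := linePoly φ (graphPt v a) (graphPt v b) with hχ
  let g := Ideal.Quotient.mkₐ F (Ideal.span {χ})
  have hg (f : Polynomial F) : g f = 0 ↔ χ ∣ f :=
    Ideal.Quotient.eq_zero_iff_mem.trans Ideal.mem_span_singleton
  have key := h.biEval_left hv hD hS (Y := fun i => g (linePt (graphPt v a) (graphPt v b) i))
    (hφ.liesOn (by rw [← comp_aeval_apply]; exact (hg _).2 dvd_rfl)) hb
  rw [← comp_aeval_apply, show (fun i => algebraMap F _ (graphPt v b i)) =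
    fun i => g (Polynomial.C (graphPt v b i)) from rfl, ← biEval_comp] at key
  rw [← hg, map_add, lineBiEval, key, ← map_add]
  rw [show linePt (graphPt v a) (graphPt v b) = fun i => _ from funext (linePt_eq_sub _ _),
    aeval_tangentPoly_homothety hv hD hb, aeval_comp_C,
    eval_tangentPoly_comm hq hv hD ht hb ha, Polynomial.algebraMap_eq, map_mul, map_pow, map_neg,
    map_one]
  rw [show (1 - Polynomial.X : Polynomial F) = (-1) * (Polynomial.X - 1) by ring, mul_pow, pow_succ]
  have : ((-1 : Polynomial F) ^ t) * (-1) ^ t = 1 := by rw [← mul_pow]; simp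
  rw [← map_zero g]
  congr 1
  linear_combination (-(Polynomial.X - 1) ^ t *
    Polynomial.C (eval (graphPt v b) (tangentPoly D v a))) * this

theorem IsSegrePair.biEval_homothety (h : IsSegrePair D v t Φ G) (hq : Odd (Fintype.card F))
    (hv : IsGraphArc D v) (hD : D.card + t = Fintype.card F + 1) (ht : t ≠ 0) (hS : S ⊆ D)
    (hφ : IsArcCurve S v t φ) {a b : F} (ha : a ∈ D) (hb : b ∈ D) {K : Type*} [CommRing K]
    [Algebra F K] {Y : Fin 2 → K} (hY : aeval Y φ = 0) {r : K} (hr : ∀ i, Y i =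
      algebraMap F K (graphPt v a i) +
        r * (algebraMap F K (graphPt v b i) - algebraMap F K (graphPt v a i))) :
    biEval F (fun i => algebraMap F K (graphPt v b i)) Y Φ =
      (1 - r) ^ t * algebraMap F K (eval (graphPt v b) (tangentPoly D v a)) := by
  rw [h.biEval_right hq hv hD ht hS (hφ.liesOn hY) hb, show Y = fun i =>
    algebraMap F K (graphPt v b i) + (1 - r) *
      (algebraMap F K (graphPt v a i) - algebraMap F K (graphPt v b i)) by
        ext i; rw [hr]; ring, aeval_tangentPoly_homothety hv hD hb, aeval_comp_C,
    eval_tangentPoly_comm hq hv hD ht ha hb, map_mul, map_pow, map_neg, map_one]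
  ring

/-- A chord of the arc through a smooth point of the curve meets the curve only in its two
endpoints. -/
theorem IsArcCurve.aeval_linePoly_ne_zero (hφ : IsArcCurve S v t φ) (hq : Odd (Fintype.card F))
    (hv : IsGraphArc D v) (hD : D.card + t = Fintype.card F + 1) (ht : t ≠ 0) (hS : S ⊆ D)
    {a b : F} (ha : a ∈ D) (hb : b ∈ S) (hab : a ≠ b)
    (hc : (linePoly φ (graphPt v a) (graphPt v b)).coeff φ.totalDegree ≠ 0)
    (hd : (linePoly φ (graphPt v a) (graphPt v b)).derivative.eval 1 ≠ 0)
    {K : Type u} [Field K] [Algebra F K] {ρ : K} (h0 : ρ ≠ 0) (h1 : ρ ≠ 1) :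
    Polynomial.aeval ρ (linePoly φ (graphPt v a) (graphPt v b)) ≠ 0 := by
  intro hρ
  obtain ⟨Φ, G, h⟩ := exists_isSegrePair hq hv hD ht
  obtain ⟨A, _, _, _, P, hP, hA⟩ := exists_genericPoint hφ.irreducible
  set χ := linePoly φ (graphPt v a) P with hχ
  have hχ1 : χ.eval 1 = 0 := by rw [hχ, eval_linePoly]; simpa using hP
  obtain ⟨χ₁, hχ₁⟩ := Polynomial.dvd_iff_isRoot.2 hχ1
  rw [map_one] at hχ₁
  set T : Polynomial A := (Polynomial.X - 1) ^ t * Polynomial.C (aeval P (tangentPoly D v a))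
  set U := lineBiEval Φ (graphPt v a) P with hU
  obtain ⟨π, hπ⟩ := hA F (graphPt v b) (by rw [aeval_eq_eval]; exact hφ.eval_eq_zero b hb)
  have hπT (ψ : MvPolynomial (Fin 2) F) {K : Type u} [CommRing K] [Algebra F K] (π : A →ₐ[F] K)
    {Y : Fin 2 → K} (hπ : ∀ i, π (P i) = Y i) : π (aeval P ψ) = aeval Y ψ := by
    rw [comp_aeval_apply]; simp_rw [hπ]
  have hTmap {K : Type u} [CommRing K] [Algebra F K] (π : A →ₐ[F] K)
    {Y : Fin 2 → K} (hπ : ∀ i, π (P i) = Y i) : T.map (π : A →+* K) =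
      (Polynomial.X - 1) ^ t * Polynomial.C (aeval Y (tangentPoly D v a)) := by
    rw [← hπT _ π hπ, Polynomial.map_mul, Polynomial.map_pow, Polynomial.map_sub,
      Polynomial.map_X, Polynomial.map_one, Polynomial.map_C]
    rfl
  have hdvd : χ₁ ∣ (U - T) * (U + T) := by
    have := h.linePoly_dvd_sq_sub hS hφ hP ha
    rw [← hχ, hχ₁] at this
    exact ((dvd_mul_left _ _).trans this).trans (dvd_of_eq (by ring))
  have hbD := hS hb
  have hχb : χ.map (π : A →+* F) = linePoly φ (graphPt v a) (graphPt v b) := by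
    rw [hχ, map_linePoly]; simp_rw [hπ]
  have hcoeff : π (χ.coeff φ.totalDegree) ≠ 0 := by
    rw [← hχb, Polynomial.coeff_map] at hc; exact hc
  have hdeg : χ.natDegree = φ.totalDegree :=
    le_antisymm (natDegree_linePoly_le _ _ _)
      (Polynomial.le_natDegree_of_ne_zero fun h => hcoeff (by rw [h, map_zero]))
  have hlc : χ₁.leadingCoeff = χ.coeff φ.totalDegree := by
    rw [← hdeg, Polynomial.coeff_natDegree, hχ₁, Polynomial.leadingCoeff_mul]
    rw [show (Polynomial.X - 1 : Polynomial A) = Polynomial.X - Polynomial.C 1 by simp,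
      Polynomial.leadingCoeff_X_sub_C, one_mul]
  set κ := eval (graphPt v b) (tangentPoly D v a) with hκ
  have hκ0 : κ ≠ 0 := eval_tangentPoly_ne_zero hv ha hbD hab
  have h2 := two_ne_zero_of_odd_card hq
  set ξ := χ₁.map (π : A →+* F) with hξ
  have hχb' : linePoly φ (graphPt v a) (graphPt v b) = (Polynomial.X - 1) * ξ := by
    rw [← hχb, hχ₁]; simp [hξ]
  have hξ1 : ξ.eval 1 ≠ 0 := by
    rw [hχb'] at hd; simpa using hd
  have hcop : IsCoprime ξ ((U - T).map (π : A →+* F)) := by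
    have e1 := h.linePoly_dvd_add hq hv hD ht hS hφ ha hbD
    obtain ⟨w, hw⟩ := (dvd_mul_left ξ _).trans (dvd_of_eq hχb'.symm) |>.trans e1
    have e2 : (U - T).map (π : A →+* F) =
        Polynomial.C (-2 * κ) * (Polynomial.X - Polynomial.C 1) ^ t + w * ξ := by
      rw [Polynomial.map_sub, hTmap π hπ, hU, map_lineBiEval]
      simp_rw [hπ]
      rw [mul_comm w, ← hw, aeval_eq_eval]
      simp only [map_mul, map_neg, map_one, map_ofNat, ← hκ]
      ring
    rw [e2]
    refine IsCoprime.add_mul_right_right ?_ w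
    rw [isCoprime_mul_unit_left_right (Polynomial.isUnit_C.2 (by simp [h2, hκ0]))]
    · refine IsCoprime.pow_right ?_
      refine (((Polynomial.irreducible_X_sub_C (1 : F)).coprime_iff_not_dvd).2 ?_).symm
      rwa [Polynomial.dvd_iff_isRoot]
  obtain ⟨N, hN⟩ := Polynomial.dvd_C_leadingCoeff_pow_mul_of_isCoprime_map (π : A →+* F) hdvd
    (by rw [hlc]; exact hcoeff) hcop
  rw [hlc] at hN
  set Y : Fin 2 → K := fun i => algebraMap F K (graphPt v a i) + ρ *
    (algebraMap F K (graphPt v b i) - algebraMap F K (graphPt v a i)) with hYdef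
  have hY : aeval Y φ = 0 := by
    rw [← Polynomial.eval_map_algebraMap] at hρ
    have := map_linePoly φ (graphPt v a) (graphPt v b) (Algebra.ofId F K)
    rw [show ((Algebra.ofId F K : F →ₐ[F] K) : F →+* K) = algebraMap F K from rfl] at this
    rw [this, eval_linePoly] at hρ
    exact hρ
  obtain ⟨π', hπ'⟩ := hA K Y hY
  have hYb (i : Fin 2) : algebraMap F K (graphPt v a i) +
      ρ⁻¹ * (Y i - algebraMap F K (graphPt v a i)) = algebraMap F K (graphPt v b i) := by
    simp only [hYdef]; field_simp; ring
  have hc' : π' (χ.coeff φ.totalDegree) ≠ 0 := by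
    rw [coeff_linePoly φ _ _ le_rfl, aeval_eq_eval] at hc
    rw [hχ, coeff_linePoly φ _ _ le_rfl, comp_aeval_apply]
    have : (fun i => π' (P i - algebraMap F A (graphPt v a i))) = fun i => ρ * algebraMap F K
        (graphPt v b i - graphPt v a i) := by
      ext i; rw [map_sub, hπ', AlgHom.commutes, map_sub]; simp [hYdef]
    rw [this, aeval_mul_left_of_isHomogeneous (homogeneousComponent_isHomogeneous _ _),
      aeval_comp_C]
    exact mul_ne_zero (pow_ne_zero _ h0) ((map_ne_zero _).2 hc)
  have hρ1 : ρ⁻¹ - 1 ≠ 0 := by rw [sub_ne_zero]; simpa using h1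
  have hroot : (χ₁.map (π' : A →+* K)).eval ρ⁻¹ = 0 := by
    have e1 : (χ.map (π' : A →+* K)).eval ρ⁻¹ = 0 := by
      rw [hχ, map_linePoly, eval_linePoly]
      simp_rw [hπ', hYb]
      rw [aeval_comp_C, hφ.eval_eq_zero b hb, map_zero]
    rw [hχ₁] at e1
    simpa [hρ1] using e1
  have hfin := Polynomial.eval_dvd (x := ρ⁻¹) (Polynomial.map_dvd (π' : A →+* K) hN)
  rw [hroot, zero_dvd_iff, Polynomial.map_mul, Polynomial.eval_mul, Polynomial.map_C,
    Polynomial.eval_C, map_pow, mul_eq_zero,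
    or_iff_right (pow_ne_zero _ (show (π' : A →+* K) _ ≠ 0 from hc')), Polynomial.map_add,
    Polynomial.eval_add, hTmap π' hπ', hU, map_lineBiEval, eval_lineBiEval] at hfin
  simp_rw [hπ', hYb] at hfin
  rw [h.biEval_homothety hq hv hD ht hS hφ ha hbD hY (fun i => rfl), hYdef,
    aeval_tangentPoly_homothety hv hD ha, aeval_comp_C, ← hκ] at hfin
  simp only [Polynomial.eval_mul, Polynomial.eval_pow, Polynomial.eval_sub, Polynomial.eval_X,
    Polynomial.eval_one, Polynomial.eval_C] at hfin
  rw [← mul_assoc, ← mul_pow, sub_mul, inv_mul_cancel₀ h0, one_mul, ← two_mul] at hfin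
  have h2K : (2 : K) ≠ 0 := by
    rw [← map_ofNat (algebraMap F K) 2]; exact (map_ne_zero _).2 h2
  simp only [mul_eq_zero, h2K, false_or, map_eq_zero, hκ0, or_false] at hfin
  exact sub_ne_zero.2 (Ne.symm h1) (eq_zero_of_pow_eq_zero hfin)
end

theorem MvPolynomial.exists_irreducible_dvd_lt_card {F : Type*} [Field F] [DecidableEq F]
    (v : F → F)
    (κ : ℕ) {h : MvPolynomial (Fin 2) F} (h0 : h ≠ 0) (T : Finset F)
    (hT : ∀ a ∈ T, eval (graphPt v a) h = 0) (hκ : κ * h.totalDegree < T.card) :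
    ∃ φ, Irreducible φ ∧ φ ∣ h ∧
      κ * φ.totalDegree < (T.filter fun a => eval (graphPt v a) φ = 0).card := by
  induction h using WfDvdMonoid.induction_on_irreducible generalizing T with
  | zero => exact absurd rfl h0
  | unit u hu =>
    obtain ⟨a, ha⟩ := Finset.card_pos.1 (Nat.zero_lt_of_lt hκ)
    exact absurd (hT a ha) (hu.map (eval (graphPt v a))).ne_zero
  | mul h φ hh hφ ih =>
    by_cases hc : κ * φ.totalDegree < (T.filter fun a => eval (graphPt v a) φ = 0).card
    · exact ⟨φ, hφ, dvd_mul_right _ _, hc⟩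
    push Not at hc
    rw [totalDegree_mul_of_isDomain hφ.ne_zero hh, mul_add] at hκ
    have hsplit := Finset.card_filter_add_card_filter_not (s := T)
      (fun a => eval (graphPt v a) φ = 0)
    obtain ⟨ψ, h1, h2, h3⟩ := ih hh (T.filter fun a => ¬ eval (graphPt v a) φ = 0)
      (fun a ha => by
        rw [Finset.mem_filter] at ha
        have := hT a ha.1
        rw [map_mul, mul_eq_zero] at this
        exact this.resolve_left ha.2) (by omega)
    refine ⟨ψ, h1, h2.mul_left _, h3.trans_le (Finset.card_le_card ?_)⟩
    exact Finset.filter_subset_filter _ (Finset.filter_subset _ _)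

theorem MvPolynomial.totalDegree_pos_of_irreducible {σ F : Type*} [Field F] {φ : MvPolynomial σ F}
    (h : Irreducible φ) : 0 < φ.totalDegree := by
  rw [Nat.pos_iff_ne_zero]
  intro h0
  rw [totalDegree_eq_zero_iff_eq_C] at h0
  refine h.not_isUnit ?_
  rw [h0]
  refine IsUnit.map C (isUnit_iff_ne_zero.2 fun h1 => h.ne_zero ?_)
  rw [h0, h1, map_zero]

theorem MvPolynomial.totalDegree_pderiv_lt {σ R : Type*} [CommSemiring R] {φ : MvPolynomial σ R}
    {i : σ} (h : pderiv i φ ≠ 0) : (pderiv i φ).totalDegree < φ.totalDegree := by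
  have key : ∀ m ∈ (pderiv i φ).support, (m.sum fun _ e => e) + 1 ≤ φ.totalDegree := by
    intro m hm
    rw [mem_support_iff, coeff_pderiv] at hm
    have := le_totalDegree (mem_support_iff.2 (left_ne_zero_of_mul hm))
    rwa [Finsupp.sum_add_index' (by simp) (by simp), Finsupp.sum_single_index rfl] at this
  obtain ⟨m, hm⟩ := (support_nonempty.2 h)
  rw [totalDegree, Finset.sup_lt_iff (by have := key m hm; simp only [Nat.bot_eq_zero]; omega)]
  exact fun m hm => key m hm

/-- An irreducible polynomial over a finite field has a non-zero partial derivative. -/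
theorem MvPolynomial.exists_pderiv_ne_zero {σ F : Type*} [Finite σ] [Field F] [Finite F]
    {φ : MvPolynomial σ F} (h : Irreducible φ) : ∃ i, pderiv i φ ≠ 0 := by
  by_contra! hno
  obtain ⟨p, hp⟩ := CharP.exists F
  have hpp : p.Prime := CharP.char_is_prime F p
  have := Fact.mk hpp
  have : ExpChar F p := ExpChar.prime hpp
  have hdvd : ∀ s ∈ φ.support, ∀ i, p ∣ s i := by
    intro s hs i
    by_cases h0 : s i = 0
    · rw [h0]; exact dvd_zero p
    have h1 := coeff_pderiv φ (s - Finsupp.single i 1) (i := i)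
    have h2 : s - Finsupp.single i 1 + Finsupp.single i 1 = s :=
      tsub_add_cancel_of_le (Finsupp.single_le_iff.2 (Nat.one_le_iff_ne_zero.2 h0))
    rw [hno, coeff_zero, h2, eq_comm, mul_eq_zero, or_iff_right (mem_support_iff.1 hs)] at h1
    have h3 : ((s i : ℕ) : F) = 0 := by
      rw [← h1, ← h2]; simp
    exact (CharP.cast_eq_zero_iff F p _).1 h3
  choose! e he using fun c : F => (PerfectRing.bijective_frobenius (R := F) (p := p)).2 c
  have hpow : φ = (∑ s ∈ φ.support, monomial (s.mapRange (· / p) (Nat.zero_div p))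
      (e (coeff s φ))) ^ p := by
    rw [sum_pow_char]
    conv_lhs => rw [φ.as_sum]
    refine Finset.sum_congr rfl fun s hs => ?_
    rw [monomial_pow]
    have h1 : p • s.mapRange (· / p) (Nat.zero_div p) = s := by
      ext i
      simp [Nat.mul_div_cancel' (hdvd s hs i)]
    have h2 : e (coeff s φ) ^ p = coeff s φ := he _
    rw [h1, h2]
  rw [hpow] at h
  exact not_irreducible_pow hpp.ne_one h

section
universe u
variable {F : Type u} [Field F]

theorem derivative_aeval {B : Type*} [CommRing B] [Algebra F B] (Y : Fin 2 → Polynomial B)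
    (φ : MvPolynomial (Fin 2) F) : (aeval Y φ).derivative =
      aeval Y (pderiv 0 φ) * (Y 0).derivative + aeval Y (pderiv 1 φ) * (Y 1).derivative := by
  induction φ using MvPolynomial.induction_on with
  | C a =>
    rw [algHom_C, IsScalarTower.algebraMap_apply F B (Polynomial B), Polynomial.algebraMap_eq]
    simp
  | add p q hp hq => simp only [map_add, hp, hq]; ring
  | mul_X p i hp =>
    simp only [map_mul, Polynomial.derivative_mul, hp, pderiv_mul, map_add, aeval_X]
    fin_cases i <;> simp [pderiv_X] <;> ring

theorem eval_derivative_linePoly (φ : MvPolynomial (Fin 2) F) (a b : Fin 2 → F) (l : F) :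
    (linePoly φ a b).derivative.eval l =
      eval (fun i => a i + l * (b i - a i)) (pderiv 0 φ) * (b 0 - a 0) +
      eval (fun i => a i + l * (b i - a i)) (pderiv 1 φ) * (b 1 - a 1) := by
  have h (ψ : MvPolynomial (Fin 2) F) : (aeval (linePt a b) ψ).eval l =
      eval (fun i => a i + l * (b i - a i)) ψ := by
    rw [← aeval_eq_eval]; exact eval_linePoly ψ a b l
  rw [linePoly, derivative_aeval, Polynomial.eval_add, Polynomial.eval_mul, Polynomial.eval_mul,
    h, h]
  simp [linePt, Polynomial.algebraMap_eq]

theorem linePoly_comp_one_sub (φ : MvPolynomial (Fin 2) F) (a b : Fin 2 → F) :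
    (linePoly φ a b).comp (1 - Polynomial.X) = linePoly φ b a := by
  have := comp_aeval_apply (linePt a b)
    (Polynomial.aeval (R := F) (1 - Polynomial.X : Polynomial F)) φ
  refine Eq.trans ?_ (this.trans ?_)
  · rfl
  · rw [linePoly]
    congr 2
    ext i : 1
    simp [linePt, Polynomial.algebraMap_eq]
    ring

variable [Fintype F] [DecidableEq F] {D : Finset F} {v : F → F} {t : ℕ}

/-- A large arc has many points on an irreducible curve of small degree. -/
theorem exists_isArcCurve (hq : Odd (Fintype.card F)) (hv : IsGraphArc D v)
    (hD : D.card + t = Fintype.card F + 1) (ht : 3 ≤ t) (hbig : (4 * t - 1) ^ 2 < Fintype.card F) :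
    ∃ φ, IsArcCurve (D.filter fun a => eval (graphPt v a) φ = 0) v t φ ∧
      4 * t * φ.totalDegree < (D.filter fun a => eval (graphPt v a) φ = 0).card ∧
      φ.totalDegree ≤ 2 * t := by
  obtain ⟨s, rfl⟩ := Nat.exists_eq_add_of_le ht
  rw [show 4 * (3 + s) - 1 = 4 * s + 11 by omega] at hbig
  obtain ⟨h, hd, hD', h0⟩ := exists_ne_zero_vanishing hq hv hD (by omega) (by nlinarith)
  obtain ⟨φ, h1, h2, h3⟩ := exists_irreducible_dvd_lt_card v (4 * (3 + s)) h0 D hD'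
    ((Nat.mul_le_mul_left _ hd).trans_lt (by nlinarith))
  refine ⟨φ, ⟨h1, fun a ha => (Finset.mem_filter.1 ha).2, fun ψ hψ hz => ?_⟩, h3, ?_⟩
  · by_contra hn
    have : (D.filter fun a => eval (graphPt v a) φ = 0).card ≤ φ.totalDegree * (2 * (3 + s)) :=
      card_le_of_irreducible_of_not_dvd v _ h1.prime hn hψ
      (fun a ha => (Finset.mem_filter.1 ha).2) hz
    nlinarith
  · obtain ⟨g, rfl⟩ := h2
    rw [totalDegree_mul_of_isDomain h1.ne_zero (right_ne_zero_of_mul h0)] at hd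
    omega
end

theorem MvPolynomial.homogeneousComponent_totalDegree_ne_zero {σ R : Type*} [CommSemiring R]
    {φ : MvPolynomial σ R} (h : φ ≠ 0) : homogeneousComponent φ.totalDegree φ ≠ 0 := by
  obtain ⟨s, hs, h1⟩ := Finset.exists_mem_eq_sup _ (support_nonempty.2 h) fun s => s.degree
  intro h0
  have h2 := congrArg (coeff s) h0
  rw [coeff_homogeneousComponent, if_pos (by rw [← h1]; rfl), coeff_zero] at h2
  exact mem_support_iff.1 hs h2

theorem exists_ne_not_rel {α : Type*} [DecidableEq α] (S : Finset α) (r : α → α → Prop)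
    [DecidableRel r] {m : ℕ} (h : ∀ b ∈ S, (S.filter fun a => r a b).card ≤ m)
    (hm : 2 * m + 1 < S.card) : ∃ a ∈ S, ∃ b ∈ S, a ≠ b ∧ ¬ r a b ∧ ¬ r b a := by
  by_contra! hno
  have h1 : ((S ×ˢ S).filter fun p => r p.1 p.2).card ≤ S.card * m := by
    rw [Finset.card_filter, Finset.sum_product_right]
    simp only [← Finset.card_filter]
    exact (Finset.sum_le_sum h).trans (by simp)
  have h2 : ((S ×ˢ S).filter fun p => r p.2 p.1).card ≤ S.card * m := by
    rw [Finset.card_filter, Finset.sum_product]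
    simp only [← Finset.card_filter]
    exact (Finset.sum_le_sum h).trans (by simp)
  have h3 : S.offDiag ⊆ ((S ×ˢ S).filter fun p => r p.1 p.2) ∪
      (S ×ˢ S).filter fun p => r p.2 p.1 := by
    intro p hp
    rw [Finset.mem_offDiag] at hp
    rw [Finset.mem_union, Finset.mem_filter, Finset.mem_filter, Finset.mem_product]
    by_cases h : r p.1 p.2
    · exact Or.inl ⟨⟨hp.1, hp.2.1⟩, h⟩
    · exact Or.inr ⟨⟨hp.1, hp.2.1⟩, hno _ hp.1 _ hp.2.1 hp.2.2 h⟩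
  have h4 := (Finset.card_le_card h3).trans (Finset.card_union_le _ _)
  rw [Finset.offDiag_card] at h4
  have h5 : S.card * S.card ≤ S.card * (2 * m + 1) := by
    rw [tsub_le_iff_right] at h4
    linarith
  have := Nat.le_of_mul_le_mul_left h5 (by omega)
  omega

section
universe u
variable {F : Type u} [Field F] [DecidableEq F] {D S : Finset F} {v : F → F} {t : ℕ}
  {φ : MvPolynomial (Fin 2) F}

theorem IsGraphArc.card_filter_line_le_two (hv : IsGraphArc D v) {α β : F} (h : α ≠ 0 ∨ β ≠ 0)
    (γ : F) : (D.filter fun x => α * x + β * v x = γ).card ≤ 2 := by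
  by_contra! hlt
  obtain ⟨a, ha, b, hb, c, hc, hab, hac, hbc⟩ := Finset.two_lt_card.1 hlt
  rw [Finset.mem_filter] at ha hb hc
  have key := sub_ne_zero.2 (hv a ha.1 b hb.1 c hc.1 hab hac hbc)
  rcases h with h | h
  · refine mul_ne_zero h key ?_
    linear_combination (v b - v a) * (hc.2 - ha.2) - (v c - v a) * (hb.2 - ha.2)
  · refine mul_ne_zero h key ?_
    linear_combination (c - a) * (hb.2 - ha.2) - (b - a) * (hc.2 - ha.2)

theorem card_filter_coeff_linePoly_le (hv : IsGraphArc D v) (hφ : φ ≠ 0) {a : F} (ha : a ∈ D) :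
    ((D.erase a).filter fun b =>
      (linePoly φ (graphPt v a) (graphPt v b)).coeff φ.totalDegree = 0).card ≤ φ.totalDegree := by
  set T := (D.erase a).filter fun b =>
      (linePoly φ (graphPt v a) (graphPt v b)).coeff φ.totalDegree = 0 with hT
  have hTD : T ⊆ D.erase a := Finset.filter_subset _ _
  rw [← Finset.card_image_of_injOn ((chordSlope_injOn hv ha).mono (Finset.coe_subset.2 hTD))]
  obtain h | ⟨r, k, h, -⟩ := exists_prod_linear_mul (M := T.image (chordSlope v a))
    (homogeneousComponent_isHomogeneous φ.totalDegree φ) (by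
      intro m hm
      obtain ⟨b, hb, rfl⟩ := Finset.mem_image.1 hm
      have hb' := Finset.mem_filter.1 hb
      have hne : b - a ≠ 0 := sub_ne_zero.2 (Finset.ne_of_mem_erase hb'.1)
      have h1 := hb'.2
      rw [coeff_linePoly φ _ _ le_rfl] at h1
      have h2 := aeval_mul_left_of_isHomogeneous (B := F)
        (homogeneousComponent_isHomogeneous φ.totalDegree φ) (b - a) ![1, chordSlope v a b]
      rw [show (fun i => (b - a) * ![1, chordSlope v a b] i) =
        fun i => graphPt v b i - algebraMap F F (graphPt v a i) by
          ext i; fin_cases i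
          · simp
          · simp [chordSlope, mul_div_cancel₀ _ hne], h1] at h2
      exact (mul_eq_zero.1 h2.symm).resolve_left (pow_ne_zero _ hne))
  · exact absurd h (homogeneousComponent_totalDegree_ne_zero hφ)
  · omega

/-- A polynomial whose zeros are `0` and `1`, both simple, has degree at most two. -/
theorem Polynomial.natDegree_le_two_of_roots {K : Type*} [Field K] {P : Polynomial K}
    (hP : P.Splits) (h : ∀ ρ, P.eval ρ = 0 → ρ = 0 ∨ ρ = 1) (h0 : P.derivative.eval 0 ≠ 0)
    (h1 : P.derivative.eval 1 ≠ 0) : P.natDegree ≤ 2 := by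
  classical
  have hP0 : P ≠ 0 := by rintro rfl; simp at h0
  rw [hP.natDegree_eq_card_roots]
  have hn : P.roots.Nodup := by
    rw [Multiset.nodup_iff_count_le_one]
    intro ρ
    rw [Polynomial.count_roots]
    by_contra! hlt
    have := (Polynomial.one_lt_rootMultiplicity_iff_isRoot hP0).1 hlt
    rcases h ρ this.1 with rfl | rfl
    · exact h0 this.2
    · exact h1 this.2
  have : P.roots ≤ {0, 1} := (Multiset.le_iff_subset hn).2 fun ρ hρ => by
    simpa using h ρ (Polynomial.isRoot_of_mem_roots hρ)
  simpa using Multiset.card_le_card this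

theorem eval_derivative_linePoly_swap {F : Type*} [Field F] (φ : MvPolynomial (Fin 2) F)
    (a b : Fin 2 → F) :
    (linePoly φ b a).derivative.eval 1 = -(linePoly φ a b).derivative.eval 0 := by
  rw [← linePoly_comp_one_sub, Polynomial.derivative_comp]
  simp

variable [Fintype F]

theorem IsArcCurve.totalDegree_le_two (hφ : IsArcCurve S v t φ) (hq : Odd (Fintype.card F))
    (hv : IsGraphArc D v) (hD : D.card + t = Fintype.card F + 1) (ht : 3 ≤ t) (hS : S ⊆ D)
    (hbig : 4 * t * φ.totalDegree < S.card) (hdt : φ.totalDegree ≤ 2 * t) :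
    φ.totalDegree ≤ 2 := by
  by_contra! hd2
  obtain ⟨i, hi⟩ := exists_pderiv_ne_zero hφ.irreducible
  have hlt := totalDegree_pderiv_lt hi
  have hndvd : ¬ φ ∣ pderiv i φ := fun h => by
    obtain ⟨g, hg⟩ := h
    have hg0 : g ≠ 0 := by rintro rfl; exact hi (by rw [hg, mul_zero])
    rw [hg, totalDegree_mul_of_isDomain hφ.irreducible.ne_zero hg0] at hlt
    omega
  have hsing : (S.filter fun a => eval (graphPt v a) (pderiv i φ) = 0).card ≤
      φ.totalDegree * φ.totalDegree :=
    card_le_of_irreducible_of_not_dvd v _ hφ.irreducible.prime hndvd hlt.le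
      (fun a ha => hφ.eval_eq_zero a (Finset.mem_filter.1 ha).1)
      (fun a ha => (Finset.mem_filter.1 ha).2)
  have hsplit := Finset.card_filter_add_card_filter_not (s := S)
      (fun a => eval (graphPt v a) (pderiv i φ) = 0)
  set S' := S.filter fun a => ¬ eval (graphPt v a) (pderiv i φ) = 0 with hS'
  have hS'D : S' ⊆ D := (Finset.filter_subset _ _).trans hS
  have hder (a b : F) : (linePoly φ (graphPt v a) (graphPt v b)).derivative.eval 1 =
      eval (graphPt v b) (pderiv 0 φ) * (b - a) +
      eval (graphPt v b) (pderiv 1 φ) * (v b - v a) := by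
    rw [eval_derivative_linePoly]
    simp
  obtain ⟨a, ha, b, hb, hab, h1, h2⟩ := exists_ne_not_rel S'
    (fun a b => a ≠ b ∧ ((linePoly φ (graphPt v b) (graphPt v a)).coeff φ.totalDegree = 0 ∨
      (linePoly φ (graphPt v a) (graphPt v b)).derivative.eval 1 = 0)) (m := φ.totalDegree + 2)
    (by
      intro b hb
      have hsm : eval (graphPt v b) (pderiv 0 φ) ≠ 0 ∨ eval (graphPt v b) (pderiv 1 φ) ≠ 0 := by
        have := (Finset.mem_filter.1 hb).2
        fin_cases i
        · exact Or.inl this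
        · exact Or.inr this
      refine (Finset.card_le_card (t := ((D.erase b).filter fun a =>
        (linePoly φ (graphPt v b) (graphPt v a)).coeff φ.totalDegree = 0) ∪
        D.filter fun a => eval (graphPt v b) (pderiv 0 φ) * a +
          eval (graphPt v b) (pderiv 1 φ) * v a = eval (graphPt v b) (pderiv 0 φ) * b +
          eval (graphPt v b) (pderiv 1 φ) * v b) ?_).trans
        ((Finset.card_union_le _ _).trans (add_le_add
          (card_filter_coeff_linePoly_le hv hφ.irreducible.ne_zero (hS'D hb))
          (hv.card_filter_line_le_two hsm _)))
      intro a ha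
      rw [Finset.mem_filter] at ha
      rw [Finset.mem_union, Finset.mem_filter, Finset.mem_filter, Finset.mem_erase]
      refine ha.2.2.imp (fun h => ⟨⟨ha.2.1, hS'D ha.1⟩, h⟩) fun h => ⟨hS'D ha.1, ?_⟩
      rw [hder] at h
      linear_combination -h)
    (by nlinarith)
  push Not at h1 h2
  obtain ⟨-, h1⟩ := h1 hab
  obtain ⟨hc, h2⟩ := h2 hab.symm
  rw [eval_derivative_linePoly_swap, neg_ne_zero] at h2
  set P := linePoly φ (graphPt v a) (graphPt v b) with hP
  have hdeg : P.natDegree = φ.totalDegree :=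
    le_antisymm (natDegree_linePoly_le _ _ _) (Polynomial.le_natDegree_of_ne_zero hc)
  have hK (x : F) : (P.map (algebraMap F (AlgebraicClosure F))).derivative.eval
      (algebraMap F _ x) = algebraMap F _ (P.derivative.eval x) := by
    rw [Polynomial.derivative_map, Polynomial.eval_map, Polynomial.eval₂_at_apply]
  have := Polynomial.natDegree_le_two_of_roots (IsAlgClosed.splits
    (P.map (algebraMap F (AlgebraicClosure F)))) (fun ρ hρ => by
      by_contra! h
      refine hφ.aeval_linePoly_ne_zero hq hv hD (by omega) hS (hS'D ha)
        (Finset.mem_filter.1 hb).1 hab hc h1 h.1 h.2 ?_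
      rwa [Polynomial.eval_map_algebraMap] at hρ)
    (by
      have := hK 0
      rw [map_zero] at this
      rw [this]; simpa using h2)
    (by
      have := hK 1
      rw [map_one] at this
      rw [this]; simpa using h1)
  rw [Polynomial.natDegree_map, hdeg] at this
  omega
end

section
variable {F : Type*} [Field F] {φ : MvPolynomial (Fin 2) F}

theorem exists_line {x y : Fin 2 → F} (h : x 0 ≠ y 0) : ∃ ψ : MvPolynomial (Fin 2) F, ψ ≠ 0 ∧
    ψ.totalDegree ≤ 1 ∧
    ∀ z, eval z ψ = (y 0 - x 0) * (z 1 - x 1) - (y 1 - x 1) * (z 0 - x 0) := by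
  have hz (z : Fin 2 → F) : eval z (C (y 0 - x 0) * (X 1 - C (x 1)) -
      C (y 1 - x 1) * (X 0 - C (x 0)) : MvPolynomial (Fin 2) F) =
      (y 0 - x 0) * (z 1 - x 1) - (y 1 - x 1) * (z 0 - x 0) := by
    simp
  have hX (c d : F) (i : Fin 2) :
      (C c * (X i - C d) : MvPolynomial (Fin 2) F).totalDegree ≤ 1 := by
    refine (totalDegree_mul _ _).trans ?_
    rw [totalDegree_C, zero_add]
    refine (totalDegree_sub _ _).trans ?_
    rw [totalDegree_X, totalDegree_C]
    simp
  refine ⟨_, fun h0 => ?_, ?_, hz⟩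
  · have := hz ![x 0, x 1 + 1]
    rw [h0] at this
    simp only [map_zero, Matrix.cons_val_zero, Matrix.cons_val_one] at this
    exact sub_ne_zero.2 h (by linear_combination this)
  · exact (totalDegree_sub _ _).trans (max_le (hX _ _ _) (hX _ _ _))

theorem MvPolynomial.not_dvd_of_totalDegree_lt {σ : Type*} {φ ψ : MvPolynomial σ F} (h0 : ψ ≠ 0)
    (h : ψ.totalDegree < φ.totalDegree) : ¬ φ ∣ ψ := by
  rintro ⟨g, rfl⟩
  rw [totalDegree_mul_of_isDomain (left_ne_zero_of_mul h0) (right_ne_zero_of_mul h0)] at h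
  omega

/-- An irreducible conic does not contain three collinear points. -/
theorem not_collinear_of_irreducible [DecidableEq F] (h : Irreducible φ) (hd : φ.totalDegree = 2)
    {x y z : Fin 2 → F} (hx : eval x φ = 0) (hy : eval y φ = 0) (hz : eval z φ = 0)
    (hxy : x 0 ≠ y 0) (hxz : x 0 ≠ z 0) (hyz : y 0 ≠ z 0) :
    (y 0 - x 0) * (z 1 - x 1) ≠ (y 1 - x 1) * (z 0 - x 0) := by
  intro hc
  obtain ⟨ψ, h0, h1, hψ⟩ := exists_line hxy
  let w : F → F := fun a => if a = x 0 then x 1 else if a = y 0 then y 1 else z 1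
  have e1 : ![x 0, w (x 0)] = x := by ext i; fin_cases i <;> simp [w]
  have e2 : ![y 0, w (y 0)] = y := by ext i; fin_cases i <;> simp [w, hxy.symm]
  have e3 : ![z 0, w (z 0)] = z := by ext i; fin_cases i <;> simp [w, hxz.symm, hyz.symm]
  have := card_le_of_irreducible_of_not_dvd w {x 0, y 0, z 0} h.prime
    (not_dvd_of_totalDegree_lt h0 (by omega)) h1
    (by simp [e1, e2, e3, hx, hy, hz]) (by
      simp only [Finset.mem_insert, Finset.mem_singleton, forall_eq_or_imp, forall_eq, e1, e2, e3,
        hψ, sub_self, mul_zero, true_and]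
      exact ⟨by ring, sub_eq_zero.2 hc⟩)
  rw [hd, Finset.card_eq_three.2 ⟨_, _, _, hxy, hxz, hyz, rfl⟩] at this
  omega

end

section
universe u
variable {F : Type u} [Field F] [DecidableEq F] {D S : Finset F} {v : F → F} {t : ℕ}
  {φ : MvPolynomial (Fin 2) F}

theorem IsGraphArc.two_le_totalDegree (hv : IsGraphArc D v) (hS : S ⊆ D) (h : Irreducible φ)
    (h0 : ∀ a ∈ S, eval (graphPt v a) φ = 0) (h3 : 2 < S.card) : 2 ≤ φ.totalDegree := by
  by_contra! hlt
  obtain ⟨a, ha, b, hb, c, hc, hab, hac, hbc⟩ := Finset.two_lt_card.1 h3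
  obtain ⟨ψ, -, h1, hψ⟩ := exists_line (x := graphPt v a) (y := graphPt v b) hab
  refine hv a (hS ha) b (hS hb) c (hS hc) hab hac hbc ?_
  have hdvd : φ ∣ ψ := by
    by_contra hn
    have := card_le_of_irreducible_of_not_dvd v {a, b} h.prime hn h1
      (by
        simp only [Finset.mem_insert, Finset.mem_singleton, forall_eq_or_imp, forall_eq]
        exact ⟨h0 a ha, h0 b hb⟩)
      (by
        simp only [Finset.mem_insert, Finset.mem_singleton, forall_eq_or_imp, forall_eq, hψ]
        simp [mul_comm])
    rw [Finset.card_pair hab] at this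
    omega
  obtain ⟨g, rfl⟩ := hdvd
  have := hψ (graphPt v c)
  rw [map_mul, h0 c hc, zero_mul] at this
  simp only [graphPt_zero, graphPt_one] at this
  linear_combination this

variable [Fintype F]

theorem IsArcCurve.eval_eq_zero_of_mem (hφ : IsArcCurve S v t φ) (hq : Odd (Fintype.card F))
    (hv : IsGraphArc D v) (hD : D.card + t = Fintype.card F + 1) (ht : t ≠ 0) (hS : S ⊆ D)
    (hd : φ.totalDegree = 2) (hcard : 4 < S.card) {a : F} (ha : a ∈ D) :
    eval (graphPt v a) φ = 0 := by
  by_contra hne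
  have haS : a ∉ S := fun h => hne (hφ.eval_eq_zero a h)
  set P : F → Polynomial F := fun b => linePoly φ (graphPt v a) (graphPt v b) with hP
  have hev (b l : F) : (P b).eval l =
      eval (fun i => graphPt v a i + l * (graphPt v b i - graphPt v a i)) φ := by
    rw [← aeval_eq_eval]; exact eval_linePoly φ _ _ l
  have hquad (b : F) : P b = Polynomial.C ((P b).coeff 2) * Polynomial.X ^ 2 +
      Polynomial.C ((P b).coeff 1) * Polynomial.X + Polynomial.C (eval (graphPt v a) φ) := by
    have h0 : (P b).coeff 0 = eval (graphPt v a) φ := by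
      rw [Polynomial.coeff_zero_eq_eval_zero, hev]; simp
    rw [← h0]
    exact Polynomial.eq_quadratic_of_degree_le_two
      (Polynomial.degree_le_of_natDegree_le ((natDegree_linePoly_le _ _ _).trans hd.le))
  have hsum (b : F) (hb : b ∈ S) :
      (P b).coeff 2 + (P b).coeff 1 + eval (graphPt v a) φ = 0 := by
    have h1 := hev b 1
    rw [hquad b] at h1
    simpa [hφ.eval_eq_zero b hb] using h1
  have hder (b l : F) : (P b).derivative.eval l = 2 * (P b).coeff 2 * l + (P b).coeff 1 := by
    conv_lhs => rw [hquad b]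
    simp; ring
  have hlin (b : F) : (P b).coeff 1 = eval (graphPt v a) (pderiv 0 φ) * (b - a) +
      eval (graphPt v a) (pderiv 1 φ) * (v b - v a) := by
    have h1 := hder b 0
    rw [hP, eval_derivative_linePoly] at h1
    simpa using h1.symm
  have hgood : ∃ b ∈ S, (P b).coeff 2 ≠ 0 ∧ (P b).derivative.eval 1 ≠ 0 := by
    by_contra! hno
    have h2 := two_ne_zero_of_odd_card hq
    have hsub : S ⊆ ((D.erase a).filter fun b => (P b).coeff φ.totalDegree = 0) ∪
        D.filter fun b => eval (graphPt v a) (pderiv 0 φ) * b +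
          eval (graphPt v a) (pderiv 1 φ) * v b = -2 * eval (graphPt v a) φ +
          (eval (graphPt v a) (pderiv 0 φ) * a + eval (graphPt v a) (pderiv 1 φ) * v a) := by
      intro b hb
      rw [Finset.mem_union, Finset.mem_filter, Finset.mem_filter, Finset.mem_erase, hd]
      by_cases hc : (P b).coeff 2 = 0
      · exact Or.inl ⟨⟨fun h => haS (h ▸ hb), hS hb⟩, hc⟩
      · refine Or.inr ⟨hS hb, ?_⟩
        have h1 := hno b hb hc
        rw [hder] at h1
        linear_combination 2 * hsum b hb - h1 - hlin b
    by_cases hline : eval (graphPt v a) (pderiv 0 φ) ≠ 0 ∨ eval (graphPt v a) (pderiv 1 φ) ≠ 0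
    · have := (Finset.card_le_card hsub).trans ((Finset.card_union_le _ _).trans (add_le_add
        (card_filter_coeff_linePoly_le hv hφ.irreducible.ne_zero ha)
        (hv.card_filter_line_le_two hline _)))
      omega
    · push Not at hline
      rw [hline.1, hline.2, Finset.filter_false_of_mem (s := D) (by
        intro b _ h
        refine mul_ne_zero h2 hne ?_
        linear_combination h), Finset.union_empty] at hsub
      have := (Finset.card_le_card hsub).trans
        (card_filter_coeff_linePoly_le hv hφ.irreducible.ne_zero ha)
      omega
  obtain ⟨b, hb, hc, h1⟩ := hgood
  have hs := hsum b hb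
  refine hφ.aeval_linePoly_ne_zero hq hv hD ht hS ha hb (fun h => haS (h ▸ hb)) (by rwa [hd]) h1
    (K := F) (ρ := eval (graphPt v a) φ / (P b).coeff 2) (div_ne_zero hne hc) ?_ ?_
  · rw [Ne, div_eq_one_iff_eq hc]
    intro h
    refine h1 ?_
    rw [hder]
    linear_combination hs - h
  · change Polynomial.aeval _ (P b) = 0
    rw [hquad b, Polynomial.coe_aeval_eq_eval]
    simp
    field_simp
    linear_combination eval (graphPt v a) φ * hs
end

theorem MvPolynomial.exists_eq_quadratic {R : Type*} [CommSemiring R]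
    {φ : MvPolynomial (Fin 2) R} (h : φ.totalDegree ≤ 2) : ∃ α β₀ β₁ γ₀ γ₁ γ₂ : R,
      φ = C α * X 1 ^ 2 + (C β₀ + C β₁ * X 0) * X 1 + (C γ₀ + C γ₁ * X 0 + C γ₂ * X 0 ^ 2) := by
  rw [φ.as_sum]
  refine Finset.sum_induction _ (fun ψ : MvPolynomial (Fin 2) R => ∃ α β₀ β₁ γ₀ γ₁ γ₂ : R,
    ψ = C α * X 1 ^ 2 + (C β₀ + C β₁ * X 0) * X 1 + (C γ₀ + C γ₁ * X 0 + C γ₂ * X 0 ^ 2))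
    ?_ ?_ ?_
  · rintro _ _ ⟨a, b, c, d, e, f, rfl⟩ ⟨a', b', c', d', e', f', rfl⟩
    refine ⟨a + a', b + b', c + c', d + d', e + e', f + f', ?_⟩
    simp only [map_add]
    ring
  · exact ⟨0, 0, 0, 0, 0, 0, by simp⟩
  · intro s hs
    have hs' := (le_totalDegree hs).trans h
    rw [Finsupp.sum_fintype _ _ (by simp), Fin.sum_univ_two] at hs'
    rw [monomial_eq, Finsupp.prod_fintype _ _ (by simp), Fin.prod_univ_two]
    generalize coeff s φ = c
    obtain ⟨i, hi⟩ : ∃ i, s 0 = i := ⟨_, rfl⟩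
    obtain ⟨j, hj⟩ : ∃ j, s 1 = j := ⟨_, rfl⟩
    rw [hi, hj] at hs' ⊢
    have : (i = 0 ∧ j = 0) ∨ (i = 1 ∧ j = 0) ∨ (i = 2 ∧ j = 0) ∨ (i = 0 ∧ j = 1) ∨
      (i = 1 ∧ j = 1) ∨ (i = 0 ∧ j = 2) := by omega
    obtain ⟨rfl, rfl⟩ | ⟨rfl, rfl⟩ | ⟨rfl, rfl⟩ | ⟨rfl, rfl⟩ | ⟨rfl, rfl⟩ | ⟨rfl, rfl⟩ := this
    · exact ⟨0, 0, 0, c, 0, 0, by simp⟩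
    · exact ⟨0, 0, 0, 0, c, 0, by simp⟩
    · exact ⟨0, 0, 0, 0, 0, c, by simp⟩
    · exact ⟨0, c, 0, 0, 0, 0, by simp⟩
    · exact ⟨0, 0, c, 0, 0, 0, by simp [mul_assoc]⟩
    · exact ⟨c, 0, 0, 0, 0, 0, by simp⟩

section
universe u
variable {F : Type u} [Field F] [Fintype F] [DecidableEq F] {D : Finset F} {v : F → F} {t : ℕ}
  {φ : MvPolynomial (Fin 2) F}

/-- A conic through a large arc consisting of points of a graph is at most linear in the
second variable. -/
theorem IsGraphArc.coeff_sq_eq_zero (hv : IsGraphArc D v) (hq : Odd (Fintype.card F))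
    (hD : D.card + t = Fintype.card F + 1) (hbig : 2 * t + 2 < Fintype.card F)
    (h : Irreducible φ) (hd : φ.totalDegree = 2) (h0 : ∀ a ∈ D, eval (graphPt v a) φ = 0)
    {α β₀ β₁ γ₀ γ₁ γ₂ : F} (hφ : φ = C α * X 1 ^ 2 + (C β₀ + C β₁ * X 0) * X 1 +
      (C γ₀ + C γ₁ * X 0 + C γ₂ * X 0 ^ 2)) : α = 0 := by
  by_contra hα
  have h2 := two_ne_zero_of_odd_card hq
  have hev (z : Fin 2 → F) : eval z φ =
      α * z 1 ^ 2 + (β₀ + β₁ * z 0) * z 1 + (γ₀ + γ₁ * z 0 + γ₂ * z 0 ^ 2) := by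
    rw [hφ]; simp
  have hpd (z : Fin 2 → F) : eval z (pderiv 1 φ) = 2 * α * z 1 + (β₀ + β₁ * z 0) := by
    rw [hφ]
    simp [pderiv_X]
    ring
  have hpd0 : pderiv 1 φ ≠ 0 := by
    intro h1
    have e1 := hpd ![0, 1]
    have e2 := hpd ![0, 0]
    rw [h1] at e1 e2
    simp at e1 e2
    rw [← e2, add_zero, eq_comm, mul_eq_zero] at e1
    exact e1.elim h2 hα
  have hlt := totalDegree_pderiv_lt hpd0
  have hdouble : (D.filter fun a => eval (graphPt v a) (pderiv 1 φ) = 0).card ≤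
      φ.totalDegree * 1 :=
    card_le_of_irreducible_of_not_dvd v _ h.prime (not_dvd_of_totalDegree_lt hpd0 hlt) (by omega)
      (fun a ha => h0 a (Finset.mem_filter.1 ha).1) (fun a ha => (Finset.mem_filter.1 ha).2)
  have hDq : D.card ≤ Fintype.card F := Finset.card_le_univ D
  obtain ⟨a₀, ha₀⟩ : D.Nonempty := Finset.card_pos.1 (by omega)
  set T := (D.filter fun a => ¬ eval (graphPt v a) (pderiv 1 φ) = 0).erase a₀ with hT
  have hTD : ∀ a ∈ T, a ∈ D ∧ a ≠ a₀ := fun a ha =>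
    ⟨(Finset.mem_filter.1 (Finset.mem_of_mem_erase ha)).1, Finset.ne_of_mem_erase ha⟩
  have hTcard : T.card ≤ t := by
    rw [← card_tangentSlopes hv hD ha₀]
    let w : F → F := fun a => -(v a) - (β₀ + β₁ * a) / α
    have hw : ∀ a ∈ T, w a ≠ v a := by
      intro a ha h1
      refine (Finset.mem_filter.1 (Finset.mem_of_mem_erase ha)).2 ?_
      rw [hpd, graphPt_zero, graphPt_one]
      simp only [w] at h1
      field_simp at h1
      linear_combination -h1
    have hw0 : ∀ a ∈ T, eval ![a, w a] φ = 0 := by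
      intro a ha
      have h1 := h0 a (hTD a ha).1
      rw [hev, graphPt_zero, graphPt_one] at h1
      rw [hev]
      simp only [w, Matrix.cons_val_zero, Matrix.cons_val_one]
      field_simp
      linear_combination α * h1
    refine Finset.card_le_card_of_injOn (fun a => (w a - v a₀) / (a - a₀)) ?_ ?_
    · intro a ha
      rw [Finset.mem_coe] at ha
      rw [Finset.mem_coe, tangentSlopes, Finset.mem_sdiff]
      refine ⟨Finset.mem_univ _, fun hm => ?_⟩
      obtain ⟨x, hx, hxa⟩ := Finset.mem_image.1 hm
      have hx0 := Finset.ne_of_mem_erase hx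
      have n1 := sub_ne_zero.2 hx0
      have n2 := sub_ne_zero.2 (hTD a ha).2
      simp only [chordSlope] at hxa
      rw [div_eq_div_iff n1 n2] at hxa
      have hne : x ≠ a := by
        rintro rfl
        exact hw x ha (by linear_combination -(mul_right_cancel₀ n1 hxa))
      refine not_collinear_of_irreducible h hd (h0 a₀ ha₀)
        (h0 x (Finset.mem_of_mem_erase hx)) (hw0 a ha) hx0.symm (hTD a ha).2.symm hne ?_
      simp only [graphPt_zero, graphPt_one, Matrix.cons_val_zero, Matrix.cons_val_one]
      linear_combination -hxa
    · intro a ha b hb hab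
      rw [Finset.mem_coe] at ha hb
      by_contra hne
      have n1 := sub_ne_zero.2 (hTD a ha).2
      have n2 := sub_ne_zero.2 (hTD b hb).2
      simp only at hab
      rw [div_eq_div_iff n1 n2] at hab
      refine not_collinear_of_irreducible h hd (h0 a₀ ha₀) (hw0 a ha) (hw0 b hb)
        (hTD a ha).2.symm (hTD b hb).2.symm hne ?_
      simp only [graphPt_zero, graphPt_one, Matrix.cons_val_zero, Matrix.cons_val_one]
      linear_combination -hab
  have hsplit := Finset.card_filter_add_card_filter_not (s := D)
      (fun a => eval (graphPt v a) (pderiv 1 φ) = 0)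
  have := Finset.pred_card_le_card_erase (s := D.filter fun a =>
    ¬ eval (graphPt v a) (pderiv 1 φ) = 0) (a := a₀)
  rw [← hT] at this
  omega

/-- Segre's theorem for large arcs contained in the graph of a function. -/
theorem IsGraphArc.exists_conic (hv : IsGraphArc D v) (hq : Odd (Fintype.card F))
    (hD : D.card + t = Fintype.card F + 1) (ht : 3 ≤ t)
    (hbig : (4 * t - 1) ^ 2 < Fintype.card F) : ∃ A B : Polynomial F, A.natDegree ≤ 2 ∧
      B.natDegree ≤ 1 ∧ B ≠ 0 ∧ ∀ a ∈ D, B.eval a * v a = A.eval a := by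
  obtain ⟨φ, hφ, hcard, hdt⟩ := exists_isArcCurve hq hv hD ht hbig
  set S := D.filter fun a => eval (graphPt v a) φ = 0 with hSdef
  have hS : S ⊆ D := Finset.filter_subset _ _
  have hpos := totalDegree_pos_of_irreducible hφ.irreducible
  have hSc : 4 < S.card := lt_of_le_of_lt (by nlinarith) hcard
  have hd : φ.totalDegree = 2 := le_antisymm (hφ.totalDegree_le_two hq hv hD ht hS hcard hdt)
    (hv.two_le_totalDegree hS hφ.irreducible hφ.eval_eq_zero (by omega))
  have h0 : ∀ a ∈ D, eval (graphPt v a) φ = 0 := fun a ha =>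
    hφ.eval_eq_zero_of_mem hq hv hD (by omega) hS hd hSc ha
  have hbig' : 2 * t + 2 < Fintype.card F := by
    refine lt_of_le_of_lt ?_ hbig
    obtain ⟨s, rfl⟩ := Nat.exists_eq_add_of_le ht
    rw [show 4 * (3 + s) - 1 = 4 * s + 11 by omega]
    nlinarith
  obtain ⟨α, β₀, β₁, γ₀, γ₁, γ₂, hquad⟩ := exists_eq_quadratic hd.le
  obtain rfl := hv.coeff_sq_eq_zero hq hD hbig' hφ.irreducible hd h0 hquad
  have hev (a : F) (ha : a ∈ D) : (β₀ + β₁ * a) * v a + (γ₀ + γ₁ * a + γ₂ * a ^ 2) = 0 := by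
    have h1 := h0 a ha
    rw [hquad] at h1
    simpa using h1
  have hA : (-(Polynomial.C γ₂ * Polynomial.X ^ 2 + Polynomial.C γ₁ * Polynomial.X +
      Polynomial.C γ₀)).natDegree ≤ 2 := by
    rw [Polynomial.natDegree_neg]; exact Polynomial.natDegree_quadratic_le
  refine ⟨-(Polynomial.C γ₂ * Polynomial.X ^ 2 + Polynomial.C γ₁ * Polynomial.X +
    Polynomial.C γ₀), Polynomial.C β₁ * Polynomial.X + Polynomial.C β₀, hA,
    Polynomial.natDegree_linear_le, fun hB => ?_, fun a ha => ?_⟩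
  · have hb1 : β₁ = 0 := by simpa using congrArg (Polynomial.coeff · 1) hB
    have hb0 : β₀ = 0 := by simpa using congrArg (Polynomial.coeff · 0) hB
    have hz := Polynomial.eq_zero_of_natDegree_lt_card_of_eval_eq_zero' _ D (fun a ha => by
      have := hev a ha
      simp only [hb0, hb1] at this
      simp
      linear_combination -this) (hA.trans_lt (by
        have := Finset.card_le_card hS
        omega))
    rw [neg_eq_zero] at hz
    refine hφ.irreducible.ne_zero ?_
    have c0 : γ₀ = 0 := by simpa using congrArg (Polynomial.coeff · 0) hz
    have c1 : γ₁ = 0 := by simpa [Polynomial.coeff_X] using congrArg (Polynomial.coeff · 1) hz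
    have c2 : γ₂ = 0 := by
      simpa [Polynomial.coeff_X, Polynomial.coeff_C] using congrArg (Polynomial.coeff · 2) hz
    rw [hquad, hb0, hb1, c0, c1, c2]
    simp
  · simp
    linear_combination hev a ha
end

end

section
open Polynomial
variable {F : Type*} [Field F]

theorem card_le_of_forall_eval_eq_zero {P : F[X]} {k : ℕ} (h0 : P ≠ 0) (hP : P.natDegree ≤ k)
    {T : Finset F} (hT : ∀ x ∈ T, P.eval x = 0) : T.card ≤ k := by
  by_contra! hlt
  exact h0 (eq_zero_of_natDegree_lt_card_of_eval_eq_zero' P T hT (hP.trans_lt hlt))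

theorem natDegree_le_of_degree_lt {f : F[X]} {k : ℕ} (h : f.degree < k) : f.natDegree ≤ k :=
  natDegree_le_of_degree_le h.le

theorem degree_divX_lt {N : F[X]} {k : ℕ} (hk : k ≠ 0) (hN : N.natDegree ≤ k) :
    N.divX.degree < k := by
  refine degree_le_natDegree.trans_lt ?_
  rw [natDegree_divX_eq_natDegree_tsub_one]
  exact_mod_cast (by omega : N.natDegree - 1 < k)

theorem hammingDist_add_card_filter {F : Type*} [DecidableEq F] (D : Finset F) (u w : F → F) :
    hammingDist (fun x : D => u x) (fun x : D => w x) + (D.filter fun x => u x = w x).card =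
      D.card := by
  have h : hammingDist (fun x : D => u x) (fun x : D => w x) =
      (D.filter fun x => ¬ u x = w x).card := by
    rw [hammingDist, Finset.card_filter, Finset.card_filter]
    exact Finset.sum_coe_sort D fun x => if ¬ u x = w x then 1 else 0
  rw [h, add_comm]
  exact Finset.card_filter_add_card_filter_not _

variable [DecidableEq F]

/-- A word has error distance `|D| - k` to a Reed-Solomon code iff the maximal number of
agreements with codewords is `k`. -/
theorem errDist_RSCode_eq_iff {D : Finset F} {k : ℕ} (hk : k ≤ D.card) (u : F → F) :
    errDist (fun x : D => u x) (RSCode D k) = D.card - k ↔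
      (∀ f : F[X], f.degree < k → (D.filter fun x => u x = f.eval x).card ≤ k) ∧
      ∃ f : F[X], f.degree < k ∧ k ≤ (D.filter fun x => u x = f.eval x).card := by
  have hset : (fun c => hammingDist (fun x : D => u x) c) '' RSCode D k =
      {n | ∃ f : F[X], f.degree < k ∧ n + (D.filter fun x => u x = f.eval x).card = D.card} := by
    ext n
    constructor
    · rintro ⟨c, ⟨f, hf, hc⟩, rfl⟩
      obtain rfl : c = fun x : D => f.eval (x : F) := funext hc
      exact ⟨f, hf, hammingDist_add_card_filter D u fun x => f.eval x⟩
    · rintro ⟨f, hf, hn⟩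
      refine ⟨fun x : D => f.eval (x : F), ⟨f, hf, fun _ => rfl⟩, ?_⟩
      have := hammingDist_add_card_filter D u fun x => f.eval x
      simp only
      omega
  rw [errDist, hset]
  have hle (f : F[X]) : (D.filter fun x => u x = f.eval x).card ≤ D.card :=
    Finset.card_filter_le _ _
  constructor
  · intro h
    have hmem := Nat.sInf_mem (s := {n | ∃ f : F[X], f.degree < k ∧
      n + (D.filter fun x => u x = f.eval x).card = D.card})
      ⟨_, show ∃ f : F[X], f.degree < k ∧ _ from ⟨0, by simp, Nat.sub_add_cancel (hle 0)⟩⟩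
    rw [h] at hmem
    obtain ⟨f, hf, hn⟩ := hmem
    refine ⟨fun g hg => ?_, f, hf, by omega⟩
    have : sInf {n | ∃ f : F[X], f.degree < k ∧
        n + (D.filter fun x => u x = f.eval x).card = D.card} ≤
        D.card - (D.filter fun x => u x = g.eval x).card :=
      Nat.sInf_le ⟨g, hg, Nat.sub_add_cancel (hle g)⟩
    rw [h] at this
    have := hle g
    omega
  · rintro ⟨h1, f, hf, h2⟩
    have h3 : D.card - k + (D.filter fun x => u x = f.eval x).card = D.card := by
      have := h1 f hf
      omega
    have hmem : D.card - k ∈ {n | ∃ f : F[X], f.degree < k ∧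
      n + (D.filter fun x => u x = f.eval x).card = D.card} := ⟨f, hf, h3⟩
    refine IsLeast.csInf_eq ⟨hmem, ?_⟩
    rintro n ⟨g, hg, hn⟩
    have := h1 g hg
    omega

/-- The words `a x ^ k + f(x)` have at most, and sometimes exactly, `k` agreements. -/
theorem agreements_of_pow {D : Finset F} {k : ℕ} (hk : k ≤ D.card) {u : F → F} {a : F}
    (ha : a ≠ 0) {f : F[X]} (hf : f.degree < k) (hu : ∀ x ∈ D, u x = a * x ^ k + f.eval x) :
    (∀ g : F[X], g.degree < k → (D.filter fun x => u x = g.eval x).card ≤ k) ∧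
      ∃ g : F[X], g.degree < k ∧ k ≤ (D.filter fun x => u x = g.eval x).card := by
  constructor
  · intro g hg
    refine card_le_of_forall_eval_eq_zero (P := C a * X ^ k + (f - g)) (fun h => ha ?_) ?_ ?_
    · have := congrArg (coeff · k) h
      simpa [coeff_eq_zero_of_degree_lt hf, coeff_eq_zero_of_degree_lt hg] using this
    · refine natDegree_add_le_of_degree_le (natDegree_C_mul_X_pow_le _ _)
        (natDegree_le_of_degree_lt ((degree_sub_le _ _).trans_lt (max_lt hf hg)))
    · intro x hx
      rw [Finset.mem_filter] at hx
      simp only [eval_add, eval_mul, eval_C, eval_pow, eval_X, eval_sub]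
      rw [← hx.2, hu x hx.1]
      ring
  · obtain ⟨R, hR, hRk⟩ := Finset.exists_subset_card_eq hk
    have hdeg : (X ^ k - Lagrange.nodal R id : F[X]).degree < k := by
      have := degree_sub_lt_left (p := (X ^ k : F[X])) (q := Lagrange.nodal R id)
        (by rw [degree_X_pow, Lagrange.degree_nodal, hRk]) (pow_ne_zero _ X_ne_zero)
        (by rw [leadingCoeff_X_pow, Lagrange.nodal_monic.leadingCoeff])
      rwa [degree_X_pow] at this
    refine ⟨f + C a * (X ^ k - Lagrange.nodal R id), (degree_add_le _ _).trans_lt (max_lt hf ?_),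
      hRk.ge.trans (Finset.card_le_card fun x hx => ?_)⟩
    · rwa [degree_C_mul ha]
    · rw [Finset.mem_filter]
      refine ⟨hR hx, ?_⟩
      have : (Lagrange.nodal R id).eval x = 0 := Lagrange.eval_nodal_at_node (v := id) hx
      rw [hu x (hR hx)]
      simp [this]
      ring

/-- The words `b / x + f(x)` have at most, and sometimes exactly, `k` agreements. -/
theorem agreements_of_inv {D : Finset F} {k : ℕ} (hk : k ≤ D.card) (hk0 : k ≠ 0)
    (hD : (0 : F) ∉ D) {u : F → F} {b : F}
    (hb : b ≠ 0) {f : F[X]} (hf : f.degree < k) (hu : ∀ x ∈ D, u x = b * x⁻¹ + f.eval x) :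
    (∀ g : F[X], g.degree < k → (D.filter fun x => u x = g.eval x).card ≤ k) ∧
      ∃ g : F[X], g.degree < k ∧ k ≤ (D.filter fun x => u x = g.eval x).card := by
  have hne : ∀ x ∈ D, x ≠ 0 := fun x hx h => hD (h ▸ hx)
  constructor
  · intro g hg
    refine card_le_of_forall_eval_eq_zero (P := C b + X * (f - g)) (fun h => hb ?_) ?_ ?_
    · simpa using congrArg (eval 0) h
    · refine natDegree_add_le_of_degree_le (by simp) (natDegree_mul_le.trans ?_)
      have h1 : (f - g).degree < k := (degree_sub_le _ _).trans_lt (max_lt hf hg)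
      have h2 : (f - g).natDegree < k := by
        rcases eq_or_ne (f - g) 0 with h | h
        · rw [h, natDegree_zero]; omega
        · exact (natDegree_lt_iff_degree_lt h).2 h1
      rw [natDegree_X]
      omega
    · intro x hx
      rw [Finset.mem_filter] at hx
      have h0 := hne x hx.1
      have := hu x hx.1
      rw [hx.2] at this
      simp only [eval_add, eval_mul, eval_C, eval_X, eval_sub]
      rw [this]
      field_simp
      ring
  · obtain ⟨R, hR, hRk⟩ := Finset.exists_subset_card_eq hk
    have hw : (Lagrange.nodal R id).eval (0 : F) ≠ 0 :=
      Lagrange.eval_nodal_not_at_node fun i hi => (hne i (hR hi)).symm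
    refine ⟨f - C (b / (Lagrange.nodal R id).eval 0) * (Lagrange.nodal R id).divX,
      (degree_sub_le _ _).trans_lt (max_lt hf ?_),
      hRk.ge.trans (Finset.card_le_card fun x hx => ?_)⟩
    · rw [degree_C_mul (div_ne_zero hb hw)]
      exact degree_divX_lt hk0 (by rw [Lagrange.natDegree_nodal, hRk])
    · rw [Finset.mem_filter]
      refine ⟨hR hx, ?_⟩
      have h0 := hne x (hR hx)
      have h1 : (Lagrange.nodal R id).eval x = 0 := Lagrange.eval_nodal_at_node (v := id) hx
      have h2 := congrArg (eval x) (divX_mul_X_add (Lagrange.nodal R id))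
      rw [h1, eval_add, eval_mul, eval_X, eval_C, coeff_zero_eq_eval_zero] at h2
      rw [hu x (hR hx), eval_sub, eval_mul, eval_C]
      field_simp
      linear_combination b * h2

/-- A word with few agreements with every codeword satisfies a bilinear relation. -/
theorem exists_mul_eq_of_agreements [Fintype F] (hq : Odd (Fintype.card F)) {k : ℕ} (hk : 3 ≤ k)
    (hbig : (4 * k - 1) ^ 2 < Fintype.card F) {D : Finset F}
    (hD : D.card + 1 = Fintype.card F) {u : F → F}
    (hu : ∀ f : F[X], f.degree < k → (D.filter fun x => u x = f.eval x).card ≤ k) :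
    ∃ N B : F[X], N.natDegree ≤ k ∧ B.natDegree ≤ 1 ∧ B ≠ 0 ∧
      ∀ x ∈ D, B.eval x * u x = N.eval x := by
  obtain ⟨s, rfl⟩ := Nat.exists_eq_add_of_le hk
  have hb : s + 7 < Fintype.card F := by
    refine lt_of_le_of_lt ?_ hbig
    rw [show 4 * (3 + s) - 1 = 4 * s + 11 by omega]
    nlinarith
  obtain ⟨E, hED, hE⟩ := Finset.exists_subset_card_eq (s := D) (n := s + 1) (by omega)
  set p := Lagrange.interpolate E id u with hp
  set w := Lagrange.nodal E (id : F → F) with hw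
  have hpE : ∀ x ∈ E, p.eval x = u x := fun x hx =>
    Lagrange.eval_interpolate_at_node u Function.injective_id.injOn hx
  have hpd : p.degree < (s + 1 : ℕ) := by
    rw [← hE]; exact Lagrange.degree_interpolate_lt u Function.injective_id.injOn
  have hwE : ∀ x ∈ E, w.eval x = 0 := fun x hx => Lagrange.eval_nodal_at_node (v := id) hx
  have hwD : ∀ x ∈ D \ E, w.eval x ≠ 0 := fun x hx =>
    Lagrange.eval_nodal_not_at_node fun i hi h => (Finset.mem_sdiff.1 hx).2 (h ▸ hi)
  have hwd : w.natDegree = s + 1 := by rw [hw, Lagrange.natDegree_nodal, hE]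
  have hv : IsGraphArc (D \ E) fun x => (u x - p.eval x) / w.eval x := by
    intro a ha b hb c hc hab hac hbc h
    set v : F → F := fun x => (u x - p.eval x) / w.eval x with hvdef
    have huv : ∀ x ∈ D \ E, u x = p.eval x + w.eval x * v x := fun x hx => by
      simp only [hvdef]
      rw [mul_div_cancel₀ _ (hwD x hx)]
      ring
    set l : F[X] := C (v a) + C ((v b - v a) / (b - a)) * (X - C a) with hl
    have hld : l.natDegree ≤ 1 := by
      refine natDegree_add_le_of_degree_le (by simp) (natDegree_mul_le.trans ?_)
      simp
    have hn := sub_ne_zero.2 hab.symm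
    have la : l.eval a = v a := by simp [hl]
    have lb : l.eval b = v b := by simp [hl, div_mul_cancel₀ _ hn]
    have lc : l.eval c = v c := by
      simp only [hl, eval_add, eval_C, eval_mul, eval_sub, eval_X]
      field_simp
      linear_combination h
    have hdeg : (p + w * l).degree < (3 + s : ℕ) := by
      refine (degree_add_le _ _).trans_lt (max_lt (hpd.trans_le (by exact_mod_cast by omega)) ?_)
      refine degree_le_natDegree.trans_lt ?_
      have := natDegree_mul_le (p := w) (q := l)
      exact_mod_cast (by omega : (w * l).natDegree < 3 + s)
    have hsub : {a, b, c} ∪ E ⊆ D.filter fun x => u x = (p + w * l).eval x := by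
      intro x hx
      rw [Finset.mem_filter, eval_add, eval_mul]
      rcases Finset.mem_union.1 hx with hx | hx
      · simp only [Finset.mem_insert, Finset.mem_singleton] at hx
        rcases hx with rfl | rfl | rfl
        · exact ⟨(Finset.mem_sdiff.1 ha).1, by rw [la]; exact huv _ ha⟩
        · exact ⟨(Finset.mem_sdiff.1 hb).1, by rw [lb]; exact huv _ hb⟩
        · exact ⟨(Finset.mem_sdiff.1 hc).1, by rw [lc]; exact huv _ hc⟩
      · exact ⟨hED hx, by rw [hwE x hx, hpE x hx]; ring⟩
    have h1 := (Finset.card_le_card hsub).trans (hu _ hdeg)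
    rw [Finset.card_union_of_disjoint, Finset.card_eq_three.2 ⟨_, _, _, hab, hac, hbc, rfl⟩,
      hE] at h1
    · omega
    · rw [Finset.disjoint_left]
      intro x hx
      simp only [Finset.mem_insert, Finset.mem_singleton] at hx
      rcases hx with rfl | rfl | rfl
      · exact (Finset.mem_sdiff.1 ha).2
      · exact (Finset.mem_sdiff.1 hb).2
      · exact (Finset.mem_sdiff.1 hc).2
  have hcard := Finset.card_sdiff_of_subset hED
  obtain ⟨A, B, hA, hB, hB0, hAB⟩ := hv.exists_conic hq (t := 3 + s) (by omega) hk hbig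
  refine ⟨B * p + w * A, B, ?_, hB, hB0, fun x hx => ?_⟩
  · have h1 : p.natDegree ≤ s + 1 := natDegree_le_of_degree_lt hpd
    refine natDegree_add_le_of_degree_le (natDegree_mul_le.trans (by omega))
      (natDegree_mul_le.trans (by omega))
  · rw [eval_add, eval_mul, eval_mul]
    by_cases hxE : x ∈ E
    · rw [hpE x hxE, hwE x hxE]; ring
    · have hxD := Finset.mem_sdiff.2 ⟨hx, hxE⟩
      have := hwD x hxD
      rw [← hAB x hxD]
      field_simp
      ring

theorem eq_pow_or_inv_of_mul_eq {D : Finset F} (hD : (0 : F) ∉ D)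
    (hD' : ∀ x : F, x ≠ 0 → x ∈ D) {k : ℕ} (hk : k ≠ 0) (hkD : k + 1 < D.card) {u : F → F}
    (hu : ∀ f : F[X], f.degree < k → (D.filter fun x => u x = f.eval x).card ≤ k)
    {N B : F[X]} (hN : N.natDegree ≤ k) (hB : B.natDegree ≤ 1) (hB0 : B ≠ 0)
    (h : ∀ x ∈ D, B.eval x * u x = N.eval x) :
    (∃ a : F, a ≠ 0 ∧ ∃ f : F[X], f.degree < k ∧ ∀ x ∈ D, u x = a * x ^ k + f.eval x) ∨
    ∃ b : F, b ≠ 0 ∧ ∃ f : F[X], f.degree < k ∧ ∀ x ∈ D, u x = b * x⁻¹ + f.eval x := by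
  have hcode : ∀ f : F[X], f.degree < k → ∀ c, ¬ ∀ x ∈ D.erase c, u x = f.eval x := by
    intro f hf c hall
    have := (Finset.card_le_card (s := D.erase c) fun x hx => Finset.mem_filter.2
      ⟨Finset.mem_of_mem_erase hx, hall x hx⟩).trans (hu f hf)
    have := Finset.pred_card_le_card_erase (s := D) (a := c)
    omega
  rw [eq_X_add_C_of_natDegree_le_one hB] at h hB0
  generalize B.coeff 1 = β₁ at h hB0
  generalize B.coeff 0 = β₀ at h hB0
  simp only [eval_add, eval_mul, eval_C, eval_X] at h
  by_cases h1 : β₁ = 0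
  · have h0 : β₀ ≠ 0 := by rintro rfl; simp [h1] at hB0
    have hux : ∀ x ∈ D, u x = (C β₀⁻¹ * N).eval x := by
      intro x hx
      rw [eval_mul, eval_C, ← h x hx, h1]
      field_simp
      ring
    have hP : (C β₀⁻¹ * N).natDegree ≤ k := (natDegree_C_mul_le _ _).trans hN
    generalize C β₀⁻¹ * N = P at hux hP
    have hf : (P - C (P.coeff k) * X ^ k).degree < (k : WithBot ℕ) := by
      rw [degree_lt_iff_coeff_zero]
      intro m hm
      rw [coeff_sub, coeff_C_mul, coeff_X_pow]
      rcases eq_or_lt_of_le hm with rfl | hm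
      · simp
      · rw [coeff_eq_zero_of_natDegree_lt (hP.trans_lt hm), if_neg hm.ne']
        simp
    refine Or.inl ⟨P.coeff k, fun h0 => ?_, _, hf, fun x hx => ?_⟩
    · rw [h0] at hf
      refine hcode _ hf 0 fun x hx => ?_
      rw [hux x (Finset.mem_of_mem_erase hx)]
      simp
    · rw [hux x hx]
      simp
  by_cases h0 : β₀ = 0
  · subst h0
    have hux : ∀ x ∈ D, u x = N.coeff 0 / β₁ * x⁻¹ + (C β₁⁻¹ * N.divX).eval x := by
      intro x hx
      have hx0 : x ≠ 0 := fun h => hD (h ▸ hx)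
      have h2 := congrArg (eval x) (divX_mul_X_add N)
      rw [← h x hx] at h2
      simp only [eval_add, eval_mul, eval_X, eval_C] at h2 ⊢
      field_simp
      linear_combination -h2
    have hf : (C β₁⁻¹ * N.divX).degree < k := by
      rw [degree_C_mul (inv_ne_zero h1)]; exact degree_divX_lt hk hN
    refine Or.inr ⟨_, fun hz => ?_, _, hf, hux⟩
    refine hcode _ hf 0 fun x hx => ?_
    rw [hux x (Finset.mem_of_mem_erase hx), hz, zero_mul, zero_add]
  · exfalso
    set c := -β₀ / β₁ with hc
    have hroot : N.IsRoot c := by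
      rw [IsRoot, ← h c (hD' c (div_ne_zero (neg_ne_zero.2 h0) h1)), hc]
      field_simp
      ring
    obtain ⟨g, rfl⟩ := dvd_iff_isRoot.2 hroot
    have hg : g.degree < k := by
      rcases eq_or_ne g 0 with rfl | hg
      · simp
      · rw [natDegree_mul (X_sub_C_ne_zero c) hg, natDegree_X_sub_C] at hN
        rw [← natDegree_lt_iff_degree_lt hg]
        omega
    refine hcode (C β₁⁻¹ * g) (by rwa [degree_C_mul (inv_ne_zero h1)]) c fun x hx => ?_
    have hxc := sub_ne_zero.2 (Finset.ne_of_mem_erase hx)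
    have h2 := h x (Finset.mem_of_mem_erase hx)
    have hcb : β₁ * c = -β₀ := by rw [hc]; field_simp
    rw [eval_mul, eval_sub, eval_X, eval_C] at h2
    rw [eval_mul, eval_C]
    refine mul_left_cancel₀ (mul_ne_zero h1 hxc) ?_
    linear_combination h2 - u x * hcb - (x - c) * g.eval x * mul_inv_cancel₀ h1
end

/-- Wu–Hong conjecture for small `k`: deep holes of the primitive Reed-Solomon code
`RS_q(F_q^*, k)` come from `a·x^k` or `b·x^{q-2}` plus lower-degree terms. -/
theorem stmt16 {F : Type*} [Field F] [Fintype F] [DecidableEq F]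
    (k : ℕ) (hq : Odd (Fintype.card F)) (hk3 : 3 ≤ k)
    (hk : (k : ℝ) < (Real.sqrt (Fintype.card F) + 1) / 4)
    (u : (Finset.univ.erase (0 : F)) → F) :
    errDist u (RSCode (Finset.univ.erase (0 : F)) k) = Fintype.card F - 1 - k ↔
      ((∃ a : F, a ≠ 0 ∧ ∃ f : Polynomial F, f.degree < k ∧
          ∀ α : (Finset.univ.erase (0 : F)),
            u α = a * (α : F) ^ k + f.eval (α : F)) ∨
        (∃ b : F, b ≠ 0 ∧ ∃ f : Polynomial F, f.degree < k ∧
          ∀ α : (Finset.univ.erase (0 : F)),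
            u α = b * (α : F) ^ (Fintype.card F - 2) + f.eval (α : F))) := by
  have hbig : (4 * k - 1) ^ 2 < Fintype.card F := by
    have h1 : ((4 * k - 1 : ℕ) : ℝ) < Real.sqrt (Fintype.card F) := by
      rw [Nat.cast_sub (by omega)]
      push_cast
      linarith
    have h2 := (Real.lt_sqrt (Nat.cast_nonneg _)).1 h1
    exact_mod_cast h2
  have hkq : k + 2 < Fintype.card F := by
    refine lt_of_le_of_lt ?_ hbig
    obtain ⟨s, rfl⟩ := Nat.exists_eq_add_of_le hk3
    rw [show 4 * (3 + s) - 1 = 4 * s + 11 by omega]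
    nlinarith
  have hcard : (Finset.univ.erase (0 : F)).card = Fintype.card F - 1 := by
    rw [Finset.card_erase_of_mem (Finset.mem_univ _), Finset.card_univ]
  have hD0 : (0 : F) ∉ Finset.univ.erase (0 : F) := Finset.notMem_erase _ _
  obtain ⟨w, rfl⟩ : ∃ w : F → F, u = fun x : (Finset.univ.erase (0 : F) : Finset F) => w x :=
    ⟨fun x => if h : x ∈ Finset.univ.erase (0 : F) then u ⟨x, h⟩ else 0,
      funext fun x => by
      have := x.2
      simp [-Finset.mem_erase, this]⟩
  have hpow : ∀ x ∈ Finset.univ.erase (0 : F), x ^ (Fintype.card F - 2) = x⁻¹ := by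
    intro x hx
    refine eq_inv_of_mul_eq_one_left ?_
    rw [← pow_succ, show Fintype.card F - 2 + 1 = Fintype.card F - 1 by omega]
    exact FiniteField.pow_card_sub_one_eq_one x (Finset.ne_of_mem_erase hx)
  rw [← hcard, errDist_RSCode_eq_iff (by omega)]
  simp only [Subtype.forall]
  constructor
  · rintro ⟨h, -⟩
    obtain ⟨N, B, hN, hB, hB0, hNB⟩ := exists_mul_eq_of_agreements hq hk3 hbig (by omega) h
    refine (eq_pow_or_inv_of_mul_eq hD0 (by simp) (by omega) (by omega) h hN hB hB0
      hNB).imp_right ?_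
    rintro ⟨b, hb, f, hf, hw⟩
    exact ⟨b, hb, f, hf, fun x hx => by rw [hpow x hx]; exact hw x hx⟩
  · rintro (⟨a, ha, f, hf, hw⟩ | ⟨b, hb, f, hf, hw⟩)
    · exact agreements_of_pow (by omega) ha hf hw
    · exact agreements_of_inv (by omega) (by omega) hD0 hb hf
        fun x hx => by rw [← hpow x hx]; exact hw x hx
end
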